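/- arXiv:2407.19999 — 2 statements merged into one kernel-verified Lean document; each statement's English description precedes it below -/
import Mathlib

section
/- Let R be a Cohen–Macaulay local ring with canonical module ω, of Krull dimension d ≥ 2, Gorenstein on the punctured spectrum. Then the stable annihilator of ω* = Hom_R(ω, R) equals the Auslander–Reiten annihilator of ω*, and both equal the stable annihilator of ω. -/
open CategoryTheory Opposite IsLocalRing

universe u

variable (R : Type u) [CommRing R]

/-- The Ext module `Ext^i_R(M, N)` as an object of `ModuleCat R`. -/
noncomputable def ExtMod (i : ℕ) (M N : Type u) [AddCommGroup M] [Module R M]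
    [AddCommGroup N] [Module R N] : ModuleCat.{u} R :=
  ((Ext R (ModuleCat.{u} R) i).obj (op (ModuleCat.of R M))).obj (ModuleCat.of R N)

/-- The annihilator of `Ext^i_R(M, N)`. -/
noncomputable def extAnn (i : ℕ) (M N : Type u) [AddCommGroup M] [Module R M]
    [AddCommGroup N] [Module R N] : Ideal R :=
  Module.annihilator R (ExtMod R i M N)

/-- `S` is a (first) syzygy of `M`: the kernel of a surjection from a
finitely generated free module onto `M`. -/
def IsSyzygy (M S : Type u) [AddCommGroup M] [Module R M] [AddCommGroup S] [Module R S] : Prop :=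
  ∃ (F : Type u) (_ : AddCommGroup F) (_ : Module R F) (ι : S →ₗ[R] F) (π : F →ₗ[R] M),
    Module.Free R F ∧ Module.Finite R F ∧ Function.Injective ι ∧ Function.Surjective π ∧
      LinearMap.range ι = LinearMap.ker π

/-- The submodule of `Hom_R(M,N)` of maps factoring through a free module. -/
def stablyTrivial (M N : Type u) [AddCommGroup M] [Module R M] [AddCommGroup N] [Module R N] :
    Submodule R (M →ₗ[R] N) :=
  Submodule.span R {f : M →ₗ[R] N | ∃ (F : Type u) (_ : AddCommGroup F) (_ : Module R F),
    Module.Free R F ∧ ∃ (g : M →ₗ[R] F) (h : F →ₗ[R] N), h ∘ₗ g = f}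

/-- The stable annihilator of `M`: the annihilator of `End_R(M)/P(M,M)`. -/
noncomputable def stableAnn (M : Type u) [AddCommGroup M] [Module R M] : Ideal R :=
  Module.annihilator R ((M →ₗ[R] M) ⧸ stablyTrivial R M M)

/-- The Auslander–Reiten annihilator `⋂_{i>0} ann Ext^i(M, M ⊕ R)`. -/
noncomputable def ARann (M : Type u) [AddCommGroup M] [Module R M] : Ideal R :=
  ⨅ i : ℕ, extAnn R (i + 1) M (M × R)

/-- Depth of a module over a local ring: supremum of lengths of regular sequences
contained in the maximal ideal. -/
noncomputable def moduleDepth [IsLocalRing R] (M : Type u) [AddCommGroup M] [Module R M] : ℕ∞ :=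
  sSup {n : ℕ∞ | ∃ rs : List R, (∀ r ∈ rs, r ∈ maximalIdeal R) ∧
    RingTheory.Sequence.IsRegular M rs ∧ (rs.length : ℕ∞) = n}

/-- `ω` is a canonical module of the `d`-dimensional Cohen-Macaulay local ring `R`:
it is finitely generated and `Ext^i(k, ω)` vanishes for `i ≠ d` and is `k` for `i = d`. -/
def IsCanonicalModule [IsLocalRing R] (d : ℕ) (ω : Type u) [AddCommGroup ω] [Module R ω] :
    Prop :=
  Module.Finite R ω ∧
    (∀ i : ℕ, i ≠ d → Subsingleton (ExtMod R i (ResidueField R) ω)) ∧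
    Nonempty ((ExtMod R d (ResidueField R) ω) ≃ₗ[R] ResidueField R)

/-- A Gorenstein local ring: Noetherian local, and the ring itself is a canonical module. -/
def IsGorensteinLocal (A : Type u) [CommRing A] [IsLocalRing A] : Prop :=
  IsNoetherianRing A ∧ ∃ d : ℕ, ringKrullDim A = d ∧ IsCanonicalModule A d A

/-- A regular local ring: Noetherian local whose maximal ideal is generated by
`dim` elements. -/
def IsRegularLocal (A : Type u) [CommRing A] [IsLocalRing A] : Prop :=
  IsNoetherianRing A ∧ ∃ (d : ℕ) (s : Finset A), ringKrullDim A = (d : ℕ) ∧ s.card = d ∧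
    Ideal.span (s : Set A) = maximalIdeal A

/-- `S` is an `n`-th syzygy of `M`. -/
def IsNthSyzygy : (n : ℕ) → ∀ (M S : Type u) [AddCommGroup M] [Module R M]
    [AddCommGroup S] [Module R S], Prop
  | 0 => fun M S _ _ _ _ => Nonempty (M ≃ₗ[R] S)
  | n + 1 => fun M S _ _ _ _ => ∃ (T : Type u) (_ : AddCommGroup T) (_ : Module R T),
      IsSyzygy R M T ∧ IsNthSyzygy n T S

/-- Maximal Cohen-Macaulay module: finitely generated with depth equal to the
Krull dimension of the ring. -/
def IsMCM [IsLocalRing R] (M : Type u) [AddCommGroup M] [Module R M] : Prop :=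
  Module.Finite R M ∧ (moduleDepth R M : WithBot ℕ∞) = ringKrullDim R

/-- The trace ideal of a module. -/
def traceIdeal (M : Type u) [AddCommGroup M] [Module R M] : Ideal R :=
  ⨆ f : M →ₗ[R] R, LinearMap.range f


theorem kill_homology_iff (S : ShortComplex (ModuleCat.{u} R)) (r : R) :
    (∀ x : S.homology, r • x = 0) ↔
    ∀ z : S.X₂, S.g z = 0 → ∃ w : S.X₁, S.f w = r • z := by
  let e := S.moduleCatHomologyIso.toLinearEquiv
  have h1 : (∀ x : S.homology, r • x = 0) ↔ ∀ y : S.moduleCatLeftHomologyData.H, r • y = 0 := by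
    constructor
    · intro h y
      have := congrArg e (h (e.symm y))
      simpa using this
    · intro h x
      apply e.injective
      simpa using h (e x)
  rw [h1]
  change (∀ y : (LinearMap.ker S.g.hom ⧸ LinearMap.range S.moduleCatToCycles), r • y = 0) ↔ _
  constructor
  · intro h z hz
    have := h (Submodule.Quotient.mk ⟨z, hz⟩)
    rw [← Submodule.Quotient.mk_smul, Submodule.Quotient.mk_eq_zero] at this
    obtain ⟨w, hw⟩ := this
    exact ⟨w, congrArg Subtype.val hw⟩
  · intro h y
    obtain ⟨⟨z, hz⟩, rfl⟩ := Submodule.Quotient.mk_surjective _ y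
    rw [← Submodule.Quotient.mk_smul, Submodule.Quotient.mk_eq_zero]
    obtain ⟨w, hw⟩ := h z hz
    exact ⟨w, Subtype.ext hw⟩

theorem kill_extMod_iff_cocycle (M N : Type u) [AddCommGroup M] [Module R M]
    [AddCommGroup N] [Module R N] (P : ProjectiveResolution (ModuleCat.of R M)) (n : ℕ) (i : ℕ)
    (hi : (ComplexShape.up ℕ).prev n = i) (r : R) :
    r ∈ extAnn R n M N ↔ ∀ f : P.complex.X n ⟶ ModuleCat.of R N, P.complex.d (n+1) n ≫ f = 0 →
      ∃ g : P.complex.X i ⟶ ModuleCat.of R N, P.complex.d n i ≫ g = r • f := by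
  let K := P.complex.linearYonedaObj R (ModuleCat.of R N)
  have e : ExtMod R n M N ≃ₗ[R] (K.sc' i n (n+1)).homology := (P.isoExt (R := R) n (ModuleCat.of R N) ≪≫ K.homologyIsoSc' i n (n+1) hi (by simp)).toLinearEquiv
  have h1 : r ∈ extAnn R n M N ↔ ∀ x : (K.sc' i n (n+1)).homology, r • x = 0 := by
    rw [extAnn, Module.mem_annihilator]
    constructor
    · intro h y
      have := congrArg e (h (e.symm y))
      rwa [map_smul, map_zero, e.apply_symm_apply] at this
    · intro h x
      apply e.injective
      rw [map_smul, map_zero]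
      exact h (e x)
  rw [h1, kill_homology_iff]
  rfl

theorem kill_ext_iff_cocycle {X Y : ModuleCat.{u} R} (P : ProjectiveResolution X) (n : ℕ) (r : R) :
    (∀ x : Abelian.Ext X Y (n+1), r • x = 0) ↔
     ∀ f : P.complex.X (n+1) ⟶ Y, P.complex.d (n+1+1) (n+1) ≫ f = 0 →
      ∃ g : P.complex.X n ⟶ Y, P.complex.d (n+1) n ≫ g = r • f := by
  have key : ∀ (f : P.complex.X (n+1) ⟶ Y) (hf : P.complex.d (n+1+1) (n+1) ≫ f = 0),
     r • P.extMk f (n+1+1) rfl hf = 0 ↔ ∃ g : P.complex.X n ⟶ Y, P.complex.d (n+1) n ≫ g = r • f := by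
    intro f hf
    rw [Abelian.Ext.smul_eq_comp_mk₀, P.extMk_comp_mk₀, P.extMk_eq_zero_iff _ _ _ _ n rfl]
    simp
  constructor
  · intro h f hf
    exact (key f hf).1 (h _)
  · intro h x
    obtain ⟨f, hf, rfl⟩ := P.extMk_surjective x (n+1+1) rfl
    exact (key f hf).2 (h f hf)

theorem mem_extAnn_succ (M N : Type u) [AddCommGroup M] [Module R M]
    [AddCommGroup N] [Module R N] (n : ℕ) (r : R) :
    r ∈ extAnn R (n+1) M N ↔
      ∀ x : Abelian.Ext (ModuleCat.of R M) (ModuleCat.of R N) (n+1), r • x = 0 := by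
  obtain ⟨P⟩ := (inferInstance : HasProjectiveResolution (ModuleCat.of R M)).out
  rw [kill_extMod_iff_cocycle R M N P (n+1) n (by simp), kill_ext_iff_cocycle R P]

theorem ext_zero_of_subsingleton_extMod (M N : Type u) [AddCommGroup M] [Module R M]
    [AddCommGroup N] [Module R N] (n : ℕ) (h : Subsingleton (ExtMod R n M N)) 
      (x : Abelian.Ext (ModuleCat.of R M) (ModuleCat.of R N) n) : x = 0 := by
  have h1 : (1 : R) ∈ extAnn R n M N := by
    rw [extAnn, Module.mem_annihilator]
    exact fun _ => Subsingleton.elim _ _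
  cases n with
  | succ n => simpa using (mem_extAnn_succ R M N n 1).1 h1 x
  | zero =>
    obtain ⟨P⟩ := (inferInstance : HasProjectiveResolution (ModuleCat.of R M)).out
    rw [kill_extMod_iff_cocycle R M N P 0 0 (by simp)] at h1
    obtain ⟨f, rfl⟩ := Abelian.Ext.mk₀_bijective _ _ |>.2 x
    obtain ⟨g, hg⟩ := h1 (P.π.f 0 ≫ ((HomologicalComplex.singleObjXSelf _ _ _).hom ≫ f)) (by
      rw [← Category.assoc]
      erw [P.complex_d_comp_π_f_zero]
      rw [Limits.zero_comp])
    rw [P.complex.shape _ _ (by simp), Limits.zero_comp, one_smul] at hg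
    have : Epi (P.π.f 0) := inferInstance
    have h2 : (HomologicalComplex.singleObjXSelf (ComplexShape.down ℕ) 0 (ModuleCat.of R M)).hom ≫ f = 0 := by
      rw [← cancel_epi (P.π.f 0), ← hg, Limits.comp_zero]
    have h3 : f = 0 := by
      rwa [← cancel_epi (HomologicalComplex.singleObjXSelf (ComplexShape.down ℕ) 0 (ModuleCat.of R M)).hom, Limits.comp_zero]
    rw [h3, Abelian.Ext.mk₀_zero]


/-- Ext groups of modules, in the Mathlib derived-category sense. -/
noncomputable abbrev EX (n : ℕ) (M N : Type u) [AddCommGroup M] [Module R M]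
    [AddCommGroup N] [Module R N] : Type u :=
  Abelian.Ext (ModuleCat.of R M) (ModuleCat.of R N) n

section
variable {R}
variable {A B C N : Type u} [AddCommGroup A] [Module R A] [AddCommGroup B] [Module R B]
  [AddCommGroup C] [Module R C] [AddCommGroup N] [Module R N]

/-- contravariant functoriality -/
noncomputable def EXpre (N : Type u) [AddCommGroup N] [Module R N] (f : A →ₗ[R] B) (i : ℕ) :
    EX R i B N →ₗ[R] EX R i A N :=
  (Abelian.Ext.mk₀ (ModuleCat.ofHom f)).precompOfLinear R (ModuleCat.of R N) (zero_add i)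

/-- covariant functoriality -/
noncomputable def EXpost (N : Type u) [AddCommGroup N] [Module R N] (f : A →ₗ[R] B) (i : ℕ) :
    EX R i N A →ₗ[R] EX R i N B :=
  (Abelian.Ext.mk₀ (ModuleCat.ofHom f)).postcompOfLinear R (ModuleCat.of R N) (add_zero i)

theorem EXpre_comp (g : B →ₗ[R] C) (f : A →ₗ[R] B) (i : ℕ) (x : EX R i C N) :
    EXpre N f i (EXpre N g i x) = EXpre N (g ∘ₗ f) i x := by
  simp only [EXpre, Abelian.Ext.precompOfLinear, Abelian.Ext.bilinearCompOfLinear_apply_apply]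
  rw [Abelian.Ext.mk₀_comp_mk₀_assoc]
  rfl

theorem EXpre_smul (r : R) (i : ℕ) (f : A →ₗ[R] B) (x : EX R i B N) :
    EXpre N (r • f) i x = r • EXpre N f i x := by
  simp only [EXpre, Abelian.Ext.precompOfLinear, Abelian.Ext.bilinearCompOfLinear_apply_apply]
  rw [show ModuleCat.ofHom (r • f) = r • ModuleCat.ofHom f from rfl, Abelian.Ext.mk₀_smul, Abelian.Ext.smul_comp]

theorem EXpre_id (i : ℕ) (x : EX R i A N) :
    EXpre N (LinearMap.id) i x = x := by
  simp only [EXpre, Abelian.Ext.precompOfLinear, Abelian.Ext.bilinearCompOfLinear_apply_apply]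
  exact Abelian.Ext.mk₀_id_comp x

theorem EXpost_smul (r : R) (i : ℕ) (f : A →ₗ[R] B) (x : EX R i N A) :
    EXpost N (r • f) i x = r • EXpost N f i x := by
  simp only [EXpost, Abelian.Ext.postcompOfLinear, LinearMap.flip_apply, Abelian.Ext.bilinearCompOfLinear_apply_apply]
  rw [show ModuleCat.ofHom (r • f) = r • ModuleCat.ofHom f from rfl, Abelian.Ext.mk₀_smul, Abelian.Ext.comp_smul]

theorem EXpost_id (i : ℕ) (x : EX R i N A) :
    EXpost N (LinearMap.id) i x = x := by
  simp only [EXpost, Abelian.Ext.postcompOfLinear, LinearMap.flip_apply, Abelian.Ext.bilinearCompOfLinear_apply_apply]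
  exact Abelian.Ext.comp_mk₀_id x

theorem EXpost_comp (g : B →ₗ[R] C) (f : A →ₗ[R] B) (i : ℕ) (x : EX R i N A) :
    EXpost N g i (EXpost N f i x) = EXpost N (g ∘ₗ f) i x := by
  simp only [EXpost, Abelian.Ext.postcompOfLinear, LinearMap.flip_apply, Abelian.Ext.bilinearCompOfLinear_apply_apply]
  rw [Abelian.Ext.comp_assoc _ _ _ _ (zero_add 0) (by simp), Abelian.Ext.mk₀_comp_mk₀]
  rfl

/-- the Ext^0 = Hom identification -/
noncomputable def EXzero (A B : Type u) [AddCommGroup A] [Module R A] [AddCommGroup B] [Module R B] :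
    EX R 0 A B ≃ₗ[R] (A →ₗ[R] B) :=
  Abelian.Ext.linearEquiv₀.trans ModuleCat.homLinearEquiv

theorem EXpre_zero (f : A →ₗ[R] B) (h : B →ₗ[R] N) :
    EXpre N f 0 ((EXzero B N).symm h) = (EXzero A N).symm (h ∘ₗ f) := by
  simp only [EXpre, Abelian.Ext.precompOfLinear, Abelian.Ext.bilinearCompOfLinear_apply_apply, EXzero]
  exact Abelian.Ext.mk₀_comp_mk₀ _ _

variable {f : A →ₗ[R] B} {g : B →ₗ[R] C}

theorem EX_shortExact (hf : Function.Injective f) (hg : Function.Surjective g)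
    (hfg : Function.Exact f g) :
    (ShortComplex.moduleCatMk f g hfg.linearMap_comp_eq_zero).ShortExact :=
  ModuleCat.shortComplex_shortExact _ hfg hf hg

theorem EX_contra (N : Type u) [AddCommGroup N] [Module R N]
    (hf : Function.Injective f) (hg : Function.Surjective g)
    (hfg : Function.Exact f g) (i : ℕ) : ∃ δ : EX R i A N →ₗ[R] EX R (i+1) C N,
      Function.Exact (EXpre N g i) (EXpre N f i) ∧ Function.Exact (EXpre N f i) δ ∧
      Function.Exact δ (EXpre N g (i+1)) := by
  have hS := EX_shortExact hf hg hfg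
  refine ⟨hS.extClass.precompOfLinear R (ModuleCat.of R N) (add_comm 1 i), ?_, ?_, ?_⟩
  · intro x
    refine ⟨fun h => Abelian.Ext.contravariant_sequence_exact₂ hS _ x h, ?_⟩
    rintro ⟨y, rfl⟩
    rw [EXpre_comp, hfg.linearMap_comp_eq_zero]
    simpa using EXpre_smul (0 : R) i (0 : A →ₗ[R] C) y
  · intro x
    refine ⟨fun h => Abelian.Ext.contravariant_sequence_exact₁ hS _ x (add_comm 1 i) h, ?_⟩
    rintro ⟨y, rfl⟩
    exact hS.extClass_comp_assoc y (h := add_comm 1 i)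
  · intro x
    refine ⟨fun h => Abelian.Ext.contravariant_sequence_exact₃ hS _ x h (add_comm 1 i), ?_⟩
    rintro ⟨y, rfl⟩
    exact hS.comp_extClass_assoc y (add_comm 1 i)

theorem EX_co (N : Type u) [AddCommGroup N] [Module R N]
    (hf : Function.Injective f) (hg : Function.Surjective g)
    (hfg : Function.Exact f g) (i : ℕ) : ∃ δ : EX R i N C →ₗ[R] EX R (i+1) N A,
      (∀ x, δ x = 0 → x ∈ Set.range (EXpost N g i)) ∧
      (∀ x, EXpost N g i x = 0 → x ∈ Set.range (EXpost N f i)) ∧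
      (∀ x, EXpost N f (i+1) x = 0 → x ∈ Set.range δ) := by
  have hS := EX_shortExact hf hg hfg
  exact ⟨hS.extClass.postcompOfLinear R (ModuleCat.of R N) rfl, 
    fun x h => Abelian.Ext.covariant_sequence_exact₃ _ hS x rfl h,
    fun x h => Abelian.Ext.covariant_sequence_exact₂ _ hS x h,
    fun x h => Abelian.Ext.covariant_sequence_exact₁ _ hS x h rfl⟩

theorem EX_proj [Module.Projective R A] (i : ℕ) (x : EX R (i+1) A N) : x = 0 := by
  have : Projective (ModuleCat.of R A) := (IsProjective.iff_projective _).1 inferInstance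
  exact Abelian.Ext.eq_zero_of_projective x

/-- if r kills A (as r • id = 0) then r kills Ext. -/
theorem EX_kill {r : R} (h : ∀ a : A, r • a = 0) (i : ℕ) (x : EX R i A N) : r • x = 0 := by
  have : r • x = EXpre N (r • LinearMap.id) i x := by rw [EXpre_smul, EXpre_id]
  rw [this, show r • LinearMap.id = (0 : R) • (0 : A →ₗ[R] A) by ext; simp [h], EXpre_smul, zero_smul]

/-- extension: if r kills Ext^1(C,N) then r • h extends -/
theorem EX_extend (hf : Function.Injective f) (hg : Function.Surjective g)
    (hfg : Function.Exact f g) (h : A →ₗ[R] N) :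
    ∃ x : EX R 1 C N, ∀ r : R, r • x = 0 → ∃ k : B →ₗ[R] N, k ∘ₗ f = r • h := by
  obtain ⟨δ, -, h2, -⟩ := EX_contra N hf hg hfg 0
  refine ⟨δ ((EXzero A N).symm h), fun r hr => ?_⟩
  rw [← map_smul, ← map_smul] at hr
  obtain ⟨y, hy⟩ := (h2 _).1 hr
  obtain ⟨k, rfl⟩ := (EXzero B N).symm.surjective y
  rw [EXpre_zero] at hy
  exact ⟨k, (EXzero A N).symm.injective hy⟩

/-- converse: if B is projective -/
theorem EX_of_extend [Module.Projective R B] (hf : Function.Injective f) (hg : Function.Surjective g)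
    (hfg : Function.Exact f g) (x : EX R 1 C N) :
    ∃ h : A →ₗ[R] N, ∀ r : R, (∃ k : B →ₗ[R] N, k ∘ₗ f = r • h) → r • x = 0 := by
  obtain ⟨δ, -, h2, h3⟩ := EX_contra N hf hg hfg 0
  obtain ⟨y, rfl⟩ := (h3 x).1 (EX_proj 0 _)
  obtain ⟨h, rfl⟩ := (EXzero A N).symm.surjective y
  refine ⟨h, fun r ⟨k, hk⟩ => ?_⟩
  rw [← map_smul, ← map_smul, ← hk, ← EXpre_zero]
  exact (h2 _).2 ⟨_, rfl⟩

instance EX_finite [IsNoetherianRing R] [Module.Finite R A] [Module.Finite R B] (i : ℕ) :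
    Module.Finite R (EX R i A B) := ModuleCat.finite_ext R _ _ i

end


section
variable {R}

/-- `E` vanishes at the prime `p`. -/
def LZ (p : Ideal R) (E : Type u) [AddCommGroup E] [Module R E] : Prop :=
  ∀ x : E, ∃ s : R, s ∉ p ∧ s • x = 0

theorem LZ.mid {p : Ideal R} [hp : p.IsPrime] {A B C : Type u} [AddCommGroup A] [Module R A]
    [AddCommGroup B] [Module R B] [AddCommGroup C] [Module R C] {f : A →ₗ[R] B} {g : B →ₗ[R] C}
    (h : ∀ x, g x = 0 → x ∈ Set.range f) (hA : LZ p A) (hC : LZ p C) : LZ p B := by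
  intro x
  obtain ⟨s, hs, h1⟩ := hC (g x)
  rw [← map_smul] at h1
  obtain ⟨y, hy⟩ := h _ h1
  obtain ⟨t, ht, h2⟩ := hA y
  refine ⟨t * s, fun h => (hp.mem_or_mem h).elim ht hs, ?_⟩
  rw [mul_smul, ← hy, ← map_smul, h2, map_zero]

theorem LZ.of_subsingleton' {p : Ideal R} [hp : p.IsPrime] {A : Type u} [AddCommGroup A] [Module R A]
   (h : ∀ x : A, x = 0) : LZ p A := fun x => ⟨1, hp.one_notMem, by rw [one_smul, h x]⟩

theorem LZ.inj {p : Ideal R} [hp : p.IsPrime] {B C : Type u} 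
    [AddCommGroup B] [Module R B] [AddCommGroup C] [Module R C] {g : B →ₗ[R] C}
    (h : ∀ x, g x = 0 → x = 0) (hC : LZ p C) : LZ p B := fun x => by
  obtain ⟨s, hs, h1⟩ := hC (g x)
  exact ⟨s, hs, h _ (by rw [map_smul, h1])⟩

theorem LZ.zero [IsLocalRing R] {E : Type u} [AddCommGroup E] [Module R E]
    (h : LZ (maximalIdeal R) E) (x : E) : x = 0 := by
  obtain ⟨s, hs, h1⟩ := h x
  have : IsUnit s := by simpa using hs
  exact (this.smul_eq_zero).1 h1

theorem LZ.unif {p : Ideal R} [hp : p.IsPrime] {E : Type u} [AddCommGroup E] [Module R E]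
    [Module.Finite R E] (P : Submodule R E) (h : ∀ x : E, ∃ s : R, s ∉ p ∧ s • x ∈ P) : 
    ∃ s : R, s ∉ p ∧ ∀ x : E, s • x ∈ P := by
  classical
  obtain ⟨S, hS⟩ := (Module.Finite.fg_top : (⊤ : Submodule R E).FG)
  choose f hf hf' using h
  refine ⟨∏ x ∈ S, f x, fun h => ?_, fun x => ?_⟩
  · obtain ⟨x, -, hx⟩ := hp.prod_mem_iff.1 h
    exact hf x hx
  · have hx : x ∈ Submodule.span R (S : Set E) := hS ▸ Submodule.mem_top
    induction hx using Submodule.span_induction with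
    | mem x hx =>
      rw [← Finset.prod_erase_mul _ _ hx, mul_smul]
      exact P.smul_mem _ (hf' x)
    | zero => simp
    | add x y _ _ hx hy => rw [smul_add]; exact P.add_mem hx hy
    | smul a x _ hx => rw [smul_comm]; exact P.smul_mem _ hx

theorem LZ.unif0 {p : Ideal R} [hp : p.IsPrime] {E : Type u} [AddCommGroup E] [Module R E]
    [Module.Finite R E] (h : LZ p E) : ∃ s : R, s ∉ p ∧ ∀ x : E, s • x = 0 := by
  simpa using LZ.unif (p := p) (⊥ : Submodule R E) (fun x => by simpa using h x)

theorem LZ.nak {p : Ideal R} [hp : p.IsPrime] {E Q : Type u} [AddCommGroup E] [Module R E]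
    [AddCommGroup Q] [Module R Q] [Module.Finite R E] {x : R} (hx : x ∈ p) (g : E →ₗ[R] Q)
    (h : ∀ e, g e = 0 → ∃ e', x • e' = e) (hQ : LZ p Q) : LZ p E := by
  obtain ⟨s, hs, h1⟩ := LZ.unif (p := p) (E := E) (Ideal.span {x} • (⊤ : Submodule R E)) (by
    intro e
    obtain ⟨s, hs, h1⟩ := hQ (g e)
    rw [← map_smul] at h1
    obtain ⟨e', he'⟩ := h _ h1
    exact ⟨s, hs, he' ▸ Submodule.smul_mem_smul (Ideal.mem_span_singleton_self x) trivial⟩)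
  obtain ⟨q, hq, -, hc, h0⟩ := LinearMap.exists_monic_and_natDegree_eq_and_coeff_mem_pow_and_aeval_eq_zero R
    (LinearMap.lsmul R E s) (Ideal.span {x}) (by rintro _ ⟨e, rfl⟩; exact h1 e)
  refine fun e => ⟨q.eval s, fun hmem => ?_, ?_⟩
  · rw [Polynomial.eval_eq_sum_range, Finset.sum_range_succ] at hmem
    have h2 : ∑ k ∈ Finset.range q.natDegree, q.coeff k * s ^ k ∈ p := by
      refine p.sum_mem fun k hk => p.mul_mem_right _ ?_
      have h3 := hc k
      have h4 : q.natDegree - k ≠ 0 := by have := Finset.mem_range.1 hk; omega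
      exact (Ideal.span_singleton_le_iff_mem p).2 hx (Ideal.pow_le_self h4 h3)
    rw [p.add_mem_iff_right h2, hq.coeff_natDegree, one_mul] at hmem
    exact hs (hp.mem_of_pow_mem _ hmem)
  · have h5 : LinearMap.lsmul R E s = algebraMap R (Module.End R E) s := rfl
    rw [h5, Polynomial.aeval_algebraMap_apply] at h0
    have := LinearMap.congr_fun h0 e
    simpa using this
end

section
variable {R}
variable {M C : Type u} [AddCommGroup M] [Module R M] [AddCommGroup C] [Module R C]

/-- the exact sequence for multiplication by a regular element, contravariantly -/
theorem EX_mul_contra (x : R) (hx : IsSMulRegular M x) (C : Type u) [AddCommGroup C] [Module R C] (i : ℕ) :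
    ∃ g : EX R i M C →ₗ[R] EX R (i+1) (M ⧸ LinearMap.range (LinearMap.lsmul R M x)) C, 
      ∀ e, g e = 0 → ∃ e', x • e' = e := by
  obtain ⟨δ, -, h2, -⟩ := EX_contra C (f := LinearMap.lsmul R M x) (g := Submodule.mkQ _) hx 
    (Submodule.mkQ_surjective _) (LinearMap.exact_map_mkQ_range _) i
  refine ⟨δ, fun e he => ?_⟩
  obtain ⟨e', he'⟩ := (h2 e).1 he
  refine ⟨e', ?_⟩
  rw [← he', show LinearMap.lsmul R M x = x • LinearMap.id from rfl, EXpre_smul, EXpre_id]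

theorem ann_quot (x : R) {r : R} (hr : r ∈ Module.annihilator R M) : 
    r ∈ Module.annihilator R (M ⧸ LinearMap.range (LinearMap.lsmul R M x)) := by
  rw [Module.mem_annihilator] at hr ⊢
  intro m
  obtain ⟨m, rfl⟩ := Submodule.mkQ_surjective _ m
  rw [← map_smul, hr, map_zero]

theorem ann_quot_self (x : R) : 
    x ∈ Module.annihilator R (M ⧸ LinearMap.range (LinearMap.lsmul R M x)) := by
  rw [Module.mem_annihilator]
  intro m
  obtain ⟨m, rfl⟩ := Submodule.mkQ_surjective _ m
  rw [← map_smul, Submodule.mkQ_apply, Submodule.Quotient.mk_eq_zero]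
  exact ⟨m, rfl⟩

theorem ann_equiv {q : Ideal R} (e : M ≃ₗ[R] R ⧸ q) : Module.annihilator R M = q := by
  rw [e.annihilator_eq, Ideal.annihilator_quotient]

theorem regular_equiv {q : Ideal R} [hq : q.IsPrime] (e : M ≃ₗ[R] R ⧸ q) {x : R} (hx : x ∉ q) :
    IsSMulRegular M x := by
  intro a b hab
  apply e.injective
  have h := congrArg e hab
  simp only [map_smul, Algebra.smul_def] at h
  refine mul_left_cancel₀ ?_ h
  intro h0
  exact hx (Ideal.Quotient.eq_zero_iff_mem.1 h0)

theorem EX_equiv {M' : Type u} [AddCommGroup M'] [Module R M'] (e : M ≃ₗ[R] M') (i : ℕ) 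
    (x : EX R i M C) : ∃ y : EX R i M' C, EXpre C e.toLinearMap i y = x :=
  ⟨EXpre C e.symm.toLinearMap i x, by rw [EXpre_comp]; simp [EXpre_id]⟩

theorem LZ_equiv {p : Ideal R} {M' : Type u} [AddCommGroup M'] [Module R M'] (e : M ≃ₗ[R] M') (i : ℕ) 
    (h : LZ p (EX R i M' C)) : LZ p (EX R i M C) := by
  intro x
  obtain ⟨y, rfl⟩ := EX_equiv e i x
  obtain ⟨s, hs, h1⟩ := h y
  exact ⟨s, hs, by rw [← map_smul, h1, map_zero]⟩

theorem LZ_EX_of_ann {p : Ideal R} {s : R} (hs : s ∉ p) (h : s ∈ Module.annihilator R M) (i : ℕ) :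
    LZ p (EX R i M C) :=
  fun x => ⟨s, hs, EX_kill (Module.mem_annihilator.1 h) i x⟩

theorem L1 [IsNoetherianRing R] (p : Ideal R) [hp : p.IsPrime] (C : Type u) [AddCommGroup C] [Module R C]
    [Module.Finite R C] (e : ℕ) (h : ∀ i, e < i → LZ p (EX R i (R ⧸ p) C)) (M : Type u)
    [AddCommGroup M] [Module R M] [hM : Module.Finite R M] (i : ℕ) (hi : e < i) : LZ p (EX R i M C) := by
  suffices H : ∀ (I : Ideal R) (M : Type u) [AddCommGroup M] [Module R M] [hM : Module.Finite R M],
      I ≤ Module.annihilator R M → ∀ i, e < i → LZ p (EX R i M C) from H ⊥ M bot_le i hi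
  intro I
  induction I using WellFoundedGT.induction with
  | ind I IH =>
  intro M _ _ hM
  induction hM using IsNoetherianRing.induction_on_isQuotientEquivQuotientPrime R with
  | subsingleton N =>
    intro _ i _
    exact LZ_EX_of_ann hp.one_notMem (Module.mem_annihilator.2 fun _ => Subsingleton.elim _ _) i
  | quotient N q f =>
    intro hI i hi
    rw [ann_equiv f] at hI
    by_cases hqp : q.1 ≤ p
    · by_cases heq : q.1 = p
      · exact LZ_equiv (f.trans (Submodule.quotEquivOfEq _ _ heq)) i (h i hi)
      · obtain ⟨x, hxp, hxq⟩ := SetLike.exists_of_lt (lt_of_le_of_ne hqp heq)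
        have := q.2
        obtain ⟨g, hg⟩ := EX_mul_contra x (regular_equiv f hxq) C i
        refine LZ.nak hxp g hg ?_
        refine IH (I ⊔ Ideal.span {x}) ?_ _ ?_ (i+1) (by omega)
        · refine lt_of_le_of_ne le_sup_left fun hh => hxq (hI ?_)
          rw [hh]
          exact Ideal.mem_sup_right (Ideal.mem_span_singleton_self x)
        · refine sup_le (fun r hr => ann_quot x ?_) ?_
          · rw [ann_equiv f]; exact hI hr
          · rw [Ideal.span_singleton_le_iff_mem]
            exact ann_quot_self x
    · obtain ⟨s, hs, hsp⟩ := SetLike.not_le_iff_exists.1 hqp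
      exact LZ_EX_of_ann hsp (by rwa [ann_equiv f]) i
  | exact N₁ N₂ N₃ f g hf hg hfg h₁ h₃ =>
    intro hI i hi
    obtain ⟨-, h1, -⟩ := EX_contra C hf hg hfg i
    exact LZ.mid (fun x hx => (h1 x).1 hx)
      (h₃ (hI.trans (LinearMap.annihilator_le_of_surjective g hg)) i hi)
      (h₁ (hI.trans (LinearMap.annihilator_le_of_injective f hf)) i hi)

theorem L3 [IsNoetherianRing R] [IsLocalRing R] (d : ℕ) (C : Type u) [AddCommGroup C] [Module R C]
    [Module.Finite R C] (h : ∀ i, i < d → ∀ x : EX R i (R ⧸ maximalIdeal R) C, x = 0) (n : ℕ) (M : Type u)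
    [AddCommGroup M] [Module R M] [hM : Module.Finite R M] 
    (hd : ∀ q : PrimeSpectrum R, Module.annihilator R M ≤ q.1 → Order.coheight q ≤ n)
    (i : ℕ) (hi : i + n < d) (x : EX R i M C) : x = 0 := by
  induction n using Nat.strong_induction_on generalizing i M with
  | _ n IHn =>
  suffices H : LZ (maximalIdeal R) (EX R i M C) from H.zero x
  clear x
  revert i hd
  induction hM using IsNoetherianRing.induction_on_isQuotientEquivQuotientPrime R with
  | subsingleton N =>
    intro _ i _
    exact LZ_EX_of_ann (Ideal.IsPrime.one_notMem inferInstance) (Module.mem_annihilator.2 fun _ => Subsingleton.elim _ _) i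
  | quotient N q f =>
    intro hd i hi
    have hq := q.2
    have hdq := hd q (by rw [ann_equiv f])
    by_cases heq : q.1 = maximalIdeal R
    · refine LZ_equiv (f.trans (Submodule.quotEquivOfEq _ _ heq)) i ?_
      exact LZ.of_subsingleton' (h i (by omega))
    · obtain ⟨x, hxp, hxq⟩ := SetLike.exists_of_lt
        (lt_of_le_of_ne (IsLocalRing.le_maximalIdeal hq.ne_top) heq)
      obtain ⟨g, hg⟩ := EX_mul_contra x (regular_equiv f hxq) C i
      refine LZ.nak hxp g hg ?_
      have hlt : ∀ q' : PrimeSpectrum R, q < q' → Order.coheight q' + 1 ≤ n := fun q' hq' =>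
        (Order.coheight_add_one_le hq').trans hdq
      have hn : 1 ≤ n := by
        have h1 := hlt ⟨maximalIdeal R, inferInstance⟩
          (lt_of_le_of_ne (IsLocalRing.le_maximalIdeal hq.ne_top) fun hh => heq (by rw [hh]))
        have h2 : (1 : ℕ∞) ≤ n := le_trans le_add_self h1
        exact_mod_cast h2
      refine LZ.of_subsingleton' fun y => IHn (n-1) (by omega) _ ?_ (i+1) (by omega) y
      intro q' hq'
      have h1 : q.1 ≤ q'.1 := fun r hr => hq' (ann_quot x (by rwa [ann_equiv f]))
      have h2 := hlt q' (lt_of_le_of_ne h1 fun hh => hxq (by rw [hh]; exact hq' (ann_quot_self x)))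
      have h3 : ((n - 1 : ℕ) : ℕ∞) + 1 = n := by exact_mod_cast Nat.sub_add_cancel hn
      rw [← h3] at h2
      exact (ENat.add_le_add_iff_right (by simp)).1 h2
  | exact N₁ N₂ N₃ f g hf hg hfg h₁ h₃ =>
    intro hd i hi
    obtain ⟨-, h1, -⟩ := EX_contra C hf hg hfg i
    exact LZ.mid (fun x hx => (h1 x).1 hx)
      (h₃ (fun q hq => hd q ((LinearMap.annihilator_le_of_surjective g hg).trans hq)) i hi)
      (h₁ (fun q hq => hd q ((LinearMap.annihilator_le_of_injective f hf).trans hq)) i hi)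
end


section
variable {R}

theorem exists_regular [IsNoetherianRing R] (p : PrimeSpectrum R) (M : Type u)
    [AddCommGroup M] [Module R M] [Module.Finite R M]
    (hP : ∀ q : PrimeSpectrum R, p ≤ q → ∀ x : EX R 0 (R ⧸ q.1) M, x = 0) :
    ∃ x ∈ p.1, IsSMulRegular M x := by
  by_contra! hcon
  have h1 : (p.1 : Set R) ⊆ ⋃ q ∈ associatedPrimes R M, (q : Set R) := by
    rw [biUnion_associatedPrimes_eq_compl_regular R M]
    exact fun r hr => hcon r hr
  obtain ⟨q, hq, hpq⟩ := (Ideal.subset_union_prime_finite (associatedPrimes.finite R M) ⊥ ⊥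
    (f := id) (fun I hin _ _ => IsAssociatedPrime.isPrime hin)).1 h1
  obtain ⟨hqp, f, hf⟩ := (isAssociatedPrime_iff_exists_injective_linearMap _ _).1 hq
  have h2 := hP ⟨q, hqp⟩ hpq ((EXzero _ _).symm f)
  have h3 : f = 0 := by
    apply (EXzero _ _).symm.injective
    rw [h2, map_zero]
  have h4 : (1 : R ⧸ q) = 0 := hf (by rw [h3]; rfl)
  exact hqp.one_notMem (Ideal.Quotient.eq_zero_iff_mem.1 h4)

theorem L4 [IsNoetherianRing R] (p : PrimeSpectrum R) (C : Type u) [AddCommGroup C] [Module R C]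
    [Module.Finite R C] (e : ℕ)
    (h : ∀ (M : Type u) [AddCommGroup M] [Module R M] [Module.Finite R M], ∀ i, e < i → LZ p.1 (EX R i M C))
    (k t : ℕ) (M : Type u) [AddCommGroup M] [Module R M] [Module.Finite R M]
    (hP : ∀ (q : PrimeSpectrum R) (i : ℕ), (i : ℕ∞) + Order.coheight q < t →
      ∀ x : EX R i (R ⧸ q.1) M, x = 0)
    (hk : Order.coheight p + k ≤ t) (i : ℕ) (hi : e < i + k) : LZ p.1 (EX R i M C) := by
  have := p.2
  induction k generalizing t M i with
  | zero => exact h M i hi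
  | succ k IH =>
    have hkt : Order.coheight p < t := by
      refine lt_of_lt_of_le ?_ hk
      have hfin : Order.coheight p ≠ ⊤ := by
        intro h0
        rw [h0] at hk
        simp at hk
      lift Order.coheight p to ℕ using hfin with c
      exact_mod_cast (by omega : c < c + (k+1))
    obtain ⟨x, hxp, hx⟩ := exists_regular p M (fun q hpq => hP q 0 (by
      rw [Nat.cast_zero, zero_add]
      exact lt_of_le_of_lt (Order.coheight_anti hpq) hkt))
    obtain ⟨g, hg⟩ := EX_mul_contra x hx C i
    refine LZ.nak hxp g hg ?_
    cases t with
    | zero => simp at hkt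
    | succ t =>
      refine IH t _ ?_ ?_ (i+1) (by omega)
      · intro q j hj y
        obtain ⟨δ, h1, -, -⟩ := EX_co (R ⧸ q.1) (f := LinearMap.lsmul R M x) (g := Submodule.mkQ _) hx 
          (Submodule.mkQ_surjective _) (LinearMap.exact_map_mkQ_range _) j
        obtain ⟨z, rfl⟩ := h1 y (hP q (j+1) (by
          push_cast
          rw [add_right_comm]
          exact (ENat.add_lt_add_iff_right (by simp)).2 hj) _)
        rw [hP q j (lt_trans hj (by exact_mod_cast Nat.lt_succ_self t)) z, map_zero]
      · push_cast at hk
        rw [← add_assoc] at hk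
        exact (ENat.add_le_add_iff_right (by simp)).1 hk

theorem height_coheight_le {d : ℕ} (hdim : ringKrullDim R = (d : ℕ)) (p : PrimeSpectrum R) :
    p.1.height + Order.coheight p ≤ d := by
  have : Nonempty (PrimeSpectrum R) := ⟨p⟩
  have h1 := Order.krullDim_eq_iSup_height_add_coheight_of_nonempty (α := PrimeSpectrum R)
  change ringKrullDim R = _ at h1
  rw [hdim] at h1
  have h2 : (d : ℕ∞) = ⨆ a : PrimeSpectrum R, Order.height a + Order.coheight a := by exact_mod_cast h1
  rw [h2]
  have h3 : p.1.height = Order.height p := p.height_eq_orderHeight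
  rw [h3]
  exact le_iSup (fun a : PrimeSpectrum R => Order.height a + Order.coheight a) p

theorem transfer [IsNoetherianRing R] (p : Ideal R) [hp : p.IsPrime] (i : ℕ) (M : Type u)
    [AddCommGroup M] [Module R M] [Module.Finite R M] 
    (h : ∀ x : EX (Localization.AtPrime p) (i+1) (LocalizedModule p.primeCompl M) (Localization.AtPrime p), x = 0) :
    LZ p (EX R (i+1) M R) := by
  induction i generalizing M with
  | zero =>
    obtain ⟨F, _, _, hF1, hF2, π, hπ⟩ := Module.exists_finite_presentation R M
    intro x
    obtain ⟨h0, hh0⟩ := EX_of_extend (f := (LinearMap.ker π).subtype) (g := π) 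
      (Submodule.subtype_injective _) hπ (LinearMap.exact_subtype_ker_map _) x
    have hinj := LocalizedModule.map_injective p.primeCompl (LinearMap.ker π).subtype (Submodule.subtype_injective _)
    have hsur := LocalizedModule.map_surjective p.primeCompl π hπ
    have hex := LocalizedModule.map_exact p.primeCompl (LinearMap.ker π).subtype π (LinearMap.exact_subtype_ker_map _)
    obtain ⟨y, hy⟩ := EX_extend (N := Localization.AtPrime p) hinj hsur hex
      (LinearMap.extendScalarsOfIsLocalization p.primeCompl (Localization.AtPrime p) (IsLocalizedModule.map p.primeCompl (LocalizedModule.mkLinearMap p.primeCompl _)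
        (Algebra.linearMap R (Localization.AtPrime p)) h0))
    obtain ⟨k, hk⟩ := hy 1 (by rw [h y, smul_zero])
    rw [one_smul] at hk
    have := Module.finitePresentation_of_finite R F
    obtain ⟨k0, s, hk0⟩ := Module.FinitePresentation.exists_lift_of_isLocalizedModule p.primeCompl 
      (Algebra.linearMap R (Localization.AtPrime p)) ((k.restrictScalars R) ∘ₗ (LocalizedModule.mkLinearMap p.primeCompl F))
    obtain ⟨t, ht, ht'⟩ := LZ.unif0 (p := p) (E := LinearMap.range (k0 ∘ₗ (LinearMap.ker π).subtype - s.1 • h0)) (by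
      rintro ⟨_, a, rfl⟩
      have h1 : Algebra.linearMap R (Localization.AtPrime p) ((k0 ∘ₗ (LinearMap.ker π).subtype - s.1 • h0) a) = 0 := by
        have h2 := LinearMap.congr_fun hk0 a.1
        have h3 := LinearMap.congr_fun hk (LocalizedModule.mkLinearMap p.primeCompl _ a)
        simp at h2 h3
        have h4 := IsLocalizedModule.map_apply p.primeCompl (LocalizedModule.mkLinearMap p.primeCompl (LinearMap.ker π))
          (Algebra.linearMap R (Localization.AtPrime p)) h0 a
        simp only [LocalizedModule.mkLinearMap_apply] at h4
        rw [h4] at h3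
        simp only [LinearMap.sub_apply, LinearMap.comp_apply, LinearMap.smul_apply, map_sub, map_smul,
          Submodule.subtype_apply, Algebra.linearMap_apply] at h3 ⊢
        rw [h2, h3, sub_eq_zero]
        rfl
      obtain ⟨t, ht⟩ := (IsLocalizedModule.eq_zero_iff p.primeCompl (Algebra.linearMap R (Localization.AtPrime p))).1 h1
      exact ⟨t.1, t.2, Subtype.ext ht⟩)
    refine ⟨t * s, fun hmem => (hp.mem_or_mem hmem).elim ht s.2, hh0 _ ⟨t • k0, ?_⟩⟩
    ext a
    have := congrArg Subtype.val (ht' ⟨_, a, rfl⟩)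
    simp at this
    simp [mul_assoc]
    linear_combination this
  | succ i IH =>
    obtain ⟨F, _, _, hF1, hF2, π, hπ⟩ := Module.exists_finite_presentation R M
    have hinj := LocalizedModule.map_injective p.primeCompl (LinearMap.ker π).subtype (Submodule.subtype_injective _)
    have hsur := LocalizedModule.map_surjective p.primeCompl π hπ
    have hex := LocalizedModule.map_exact p.primeCompl (LinearMap.ker π).subtype π (LinearMap.exact_subtype_ker_map _)
    have h1 := IH (LinearMap.ker π) (by
      intro x
      obtain ⟨δ, -, h1, -⟩ := EX_contra (Localization.AtPrime p) hinj hsur hex (i+1)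
      obtain ⟨y, rfl⟩ := (h1 x).1 (h _)
      rw [EX_proj i y, map_zero])
    obtain ⟨δ, -, -, h2⟩ := EX_contra R (f := (LinearMap.ker π).subtype) (g := π) 
      (Submodule.subtype_injective _) hπ (LinearMap.exact_subtype_ker_map _) (i+1)
    intro x
    obtain ⟨y, rfl⟩ := (h2 x).1 (EX_proj _ _)
    obtain ⟨s, hs, hs'⟩ := h1 y
    exact ⟨s, hs, by rw [← map_smul, hs', map_zero]⟩

theorem residue_equiv (p : Ideal R) [hp : p.IsPrime] :
    Nonempty (LocalizedModule p.primeCompl (R ⧸ p) ≃ₗ[Localization.AtPrime p]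
      ResidueField (Localization.AtPrime p)) := by
  let g : Localization.AtPrime p →ₗ[Localization.AtPrime p] LocalizedModule p.primeCompl (R ⧸ p) :=
    LinearMap.toSpanSingleton _ _ (LocalizedModule.mk (1 : R ⧸ p) 1)
  have hsur : Function.Surjective g := by
    intro y
    induction y using LocalizedModule.induction_on with
    | _ m s =>
    obtain ⟨r, rfl⟩ := Ideal.Quotient.mk_surjective m
    refine ⟨Localization.mk r s, ?_⟩
    simp only [g, LinearMap.toSpanSingleton_apply, LocalizedModule.mk_smul_mk, mul_one]
    congr 1
    rw [Algebra.smul_def, mul_one]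
    rfl
  have hker : LinearMap.ker g = maximalIdeal (Localization.AtPrime p) := by
    symm
    refine (maximalIdeal.isMaximal _).eq_of_le ?_ ?_
    · intro h
      have h1 : (1 : Localization.AtPrime p) ∈ LinearMap.ker g := h ▸ Submodule.mem_top
      rw [LinearMap.mem_ker] at h1
      simp only [g, LinearMap.toSpanSingleton_apply, one_smul] at h1
      rw [← LocalizedModule.zero_mk 1, LocalizedModule.mk_eq] at h1
      obtain ⟨u, hu⟩ := h1
      simp only [one_smul, smul_zero] at hu
      apply u.2
      have : (u : R) • (1 : R ⧸ p) = 0 := hu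
      rw [Algebra.smul_def, mul_one] at this
      exact Ideal.Quotient.eq_zero_iff_mem.1 this
    · rw [← Localization.AtPrime.map_eq_maximalIdeal, Ideal.map_le_iff_le_comap]
      intro x hx
      rw [Ideal.mem_comap, LinearMap.mem_ker]
      simp only [g, LinearMap.toSpanSingleton_apply]
      rw [algebraMap_smul, LocalizedModule.smul'_mk]
      rw [Algebra.smul_def, mul_one]
      rw [show algebraMap R (R ⧸ p) x = 0 from Ideal.Quotient.eq_zero_iff_mem.2 hx]
      exact LocalizedModule.zero_mk 1
  exact ⟨(g.quotKerEquivOfSurjective hsur).symm.trans (Submodule.quotEquivOfEq _ _ hker)⟩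

theorem gor_LZ [IsNoetherianRing R] (p : Ideal R) [hp : p.IsPrime]
    (h : IsGorensteinLocal (Localization.AtPrime p)) :
    ∃ e : ℕ, p.height = e ∧ ∀ i, e < i → LZ p (EX R i (R ⧸ p) R) := by
  obtain ⟨-, e, he, -, h1, -⟩ := h
  refine ⟨e, ?_, fun i hi => ?_⟩
  · rw [IsLocalization.AtPrime.ringKrullDim_eq_height p] at he
    exact_mod_cast he
  · obtain ⟨i, rfl⟩ : ∃ j, i = j + 1 := ⟨i - 1, by omega⟩
    refine transfer p i _ fun x => ?_
    obtain ⟨f⟩ := residue_equiv p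
    obtain ⟨y, rfl⟩ := EX_equiv f (i+1) x
    rw [ext_zero_of_subsingleton_extMod _ _ _ (i+1) (h1 (i+1) (by omega)) y, map_zero]

/-- For `p` non-maximal, all positive self-dual Ext's of `ω` vanish at `p`. -/
theorem LZ_omega [IsNoetherianRing R] [IsLocalRing R] (d : ℕ) (hdim : ringKrullDim R = (d : ℕ))
    (ω : Type u) [AddCommGroup ω] [Module R ω] (hω : IsCanonicalModule R d ω)
    (p : Ideal R) [hp : p.IsPrime] (h : IsGorensteinLocal (Localization.AtPrime p)) :
    (∃ e : ℕ, ∀ (M : Type u) [AddCommGroup M] [Module R M] [Module.Finite R M], ∀ i, e < i →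
      LZ p (EX R i M R)) ∧ ∀ i, 1 ≤ i → LZ p (EX R i ω R) := by
  obtain ⟨e, he, h1⟩ := gor_LZ p h
  have h2 : ∀ (M : Type u) [AddCommGroup M] [Module R M] [Module.Finite R M], ∀ i, e < i →
      LZ p (EX R i M R) := fun M _ _ _ i hi => L1 p R e h1 M i hi
  refine ⟨⟨e, h2⟩, fun i hi => ?_⟩
  have := hω.1
  refine L4 ⟨p, hp⟩ R e h2 e d ω (fun q j hj x => ?_) ?_ i (by omega)
  · have hfin : Order.coheight q ≠ ⊤ := by
      intro h0
      rw [h0] at hj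
      simp at hj
    obtain ⟨c, hc⟩ := ENat.ne_top_iff_exists.1 hfin
    refine L3 d ω (fun i hi => ext_zero_of_subsingleton_extMod _ _ _ i (hω.2.1 i (by omega))) c
      (R ⧸ q.1) ?_ j (by rw [← hc] at hj; exact_mod_cast hj) x
    intro q' hq'
    rw [Ideal.annihilator_quotient] at hq'
    rw [hc]
    exact Order.coheight_anti hq'
  · rw [add_comm, ← he]
    exact height_coheight_le hdim ⟨p, hp⟩
end


section
variable {R}

theorem EX_shift {A B C : Type u} [AddCommGroup A] [Module R A] [AddCommGroup B] [Module R B]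
    [AddCommGroup C] [Module R C] (N : Type u) [AddCommGroup N] [Module R N] [Module.Projective R B]
    {f : A →ₗ[R] B} {g : B →ₗ[R] C}
    (hf : Function.Injective f) (hg : Function.Surjective g) (hfg : Function.Exact f g) (i : ℕ) :
    ∃ δ : EX R (i+1) A N →ₗ[R] EX R (i+2) C N, ∀ x, δ x = 0 → x = 0 := by
  obtain ⟨δ, -, h1, -⟩ := EX_contra N hf hg hfg (i+1)
  refine ⟨δ, fun x hx => ?_⟩
  obtain ⟨y, rfl⟩ := (h1 x).1 hx
  rw [EX_proj i y, map_zero]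

theorem descend {B C N : Type u} [AddCommGroup B] [Module R B]
    [AddCommGroup C] [Module R C] [AddCommGroup N] [Module R N] (g : B →ₗ[R] C)
    (hg : Function.Surjective g) (k : B →ₗ[R] N) (h : ∀ b, g b = 0 → k b = 0) :
    ∃ l : C →ₗ[R] N, ∀ b, l (g b) = k b := by
  refine ⟨(LinearMap.ker g).liftQ k h ∘ₗ (g.quotKerEquivOfSurjective hg).symm.toLinearMap, fun b => ?_⟩
  have : (g.quotKerEquivOfSurjective hg).symm (g b) = Submodule.Quotient.mk b := by
    rw [LinearEquiv.symm_apply_eq]; rfl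
  simp [this]
  rfl

variable {F M : Type u} [AddCommGroup F] [Module R F] [AddCommGroup M] [Module R M]

/-- restriction of functionals to the kernel -/
noncomputable abbrev resK (π : F →ₗ[R] M) : (F →ₗ[R] R) →ₗ[R] (LinearMap.ker π →ₗ[R] R) :=
  (LinearMap.ker π).subtype.dualMap

/-- the image of the restriction -/
noncomputable abbrev imK (π : F →ₗ[R] M) : Submodule R (LinearMap.ker π →ₗ[R] R) :=
  LinearMap.range (resK π)

theorem dual_inj (π : F →ₗ[R] M) (hπ : Function.Surjective π) : Function.Injective π.dualMap :=
  LinearMap.dualMap_injective_of_surjective hπ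

theorem dual_exact (π : F →ₗ[R] M) (hπ : Function.Surjective π) :
    Function.Exact π.dualMap (resK π).rangeRestrict := by
  intro φ
  constructor
  · intro h
    obtain ⟨l, hl⟩ := descend π hπ φ (fun b hb => by
      have h1 := congrArg Subtype.val h
      exact LinearMap.congr_fun h1 ⟨b, hb⟩)
    exact ⟨l, LinearMap.ext hl⟩
  · rintro ⟨l, rfl⟩
    apply Subtype.ext
    ext a
    have : π a.1 = 0 := a.2
    change l (π a.1) = 0
    rw [this, map_zero]

theorem ext1_kill (π : F →ₗ[R] M) (hπ : Function.Surjective π)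
    (h : (LinearMap.ker π) →ₗ[R] R) :
    ∃ x : EX R 1 M R, ∀ r : R, r • x = 0 → r • h ∈ imK π := by
  obtain ⟨x, hx⟩ := EX_extend (f := (LinearMap.ker π).subtype) (g := π) 
      (Submodule.subtype_injective _) hπ (LinearMap.exact_subtype_ker_map _) h
  exact ⟨x, fun r hr => by obtain ⟨k, hk⟩ := hx r hr; exact ⟨k, hk⟩⟩

theorem coker_LZ {p : Ideal R} (π : F →ₗ[R] M) (hπ : Function.Surjective π)
    (h : LZ p (EX R 1 M R)) : LZ p ((LinearMap.ker π →ₗ[R] R) ⧸ imK π) := by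
  intro y
  obtain ⟨y, rfl⟩ := Submodule.mkQ_surjective _ y
  obtain ⟨x, hx⟩ := ext1_kill π hπ y
  obtain ⟨s, hs, h1⟩ := h x
  refine ⟨s, hs, ?_⟩
  rw [← map_smul, Submodule.mkQ_apply, Submodule.Quotient.mk_eq_zero]
  exact hx s h1

/-- all positive Ext into `R` vanish at `p` -/
def GLZ (p : Ideal R) (M : Type u) [AddCommGroup M] [Module R M] : Prop :=
  ∀ j, LZ p (EX R (j+1) M R)

theorem GLZ.ker {p : Ideal R} [p.IsPrime] [Module.Projective R F] (π : F →ₗ[R] M) (hπ : Function.Surjective π)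
    (h : GLZ p M) : GLZ p (LinearMap.ker π) := by
  intro j
  obtain ⟨δ, hδ⟩ := EX_shift R (f := (LinearMap.ker π).subtype) (g := π) 
      (Submodule.subtype_injective _) hπ (LinearMap.exact_subtype_ker_map _) j
  exact LZ.inj hδ (h (j+1))

theorem GLZ.im [IsNoetherianRing R] {p : Ideal R} [p.IsPrime] [Module.Free R F] [Module.Finite R F]
    (π : F →ₗ[R] M) (hπ : Function.Surjective π) (h : GLZ p M) (j : ℕ)
    (h' : LZ p (EX R (j+1) (LinearMap.ker π →ₗ[R] R) R)) : LZ p (EX R (j+1) (imK π) R) := by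
  obtain ⟨δ, -, h1, -⟩ := EX_contra R (A := imK π) (B := LinearMap.ker π →ₗ[R] R) (f := (imK π).subtype) (g := (imK π).mkQ)
    (Submodule.subtype_injective _) (Submodule.mkQ_surjective _) (LinearMap.exact_subtype_mkQ _) (j+1)
  refine LZ.mid (fun x hx => (h1 x).1 hx) h' ?_
  obtain ⟨s, hs, h2⟩ := LZ.unif0 (coker_LZ π hπ (h 0))
  exact fun x => ⟨s, hs, EX_kill h2 _ x⟩

theorem GLZ.dual [IsNoetherianRing R] {p : Ideal R} [p.IsPrime] {e : ℕ}
    (hL : ∀ (M : Type u) [AddCommGroup M] [Module R M] [Module.Finite R M], ∀ i, e < i →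
      LZ p (EX R i M R)) (n : ℕ) (M : Type u) [AddCommGroup M] [Module R M] [Module.Finite R M]
    (h : GLZ p M) (i : ℕ) (hi : e < i + 1 + n) : LZ p (EX R (i+1) (M →ₗ[R] R) R) := by
  induction n generalizing M i with
  | zero => exact hL _ _ hi
  | succ n IH =>
    obtain ⟨F, _, _, hF1, hF2, π, hπ⟩ := Module.exists_finite_presentation R M
    obtain ⟨δ, hδ⟩ := EX_shift R (A := M →ₗ[R] R) (B := F →ₗ[R] R) (C := imK π) (f := π.dualMap) (g := (resK π).rangeRestrict) 
      (dual_inj π hπ) (LinearMap.surjective_rangeRestrict _) (dual_exact π hπ) i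
    refine LZ.inj hδ ?_
    exact GLZ.im π hπ h (i+1) (IH _ (h.ker π hπ) (i+1) (by omega))

theorem GLZ.dual' [IsNoetherianRing R] {p : Ideal R} [p.IsPrime] {e : ℕ}
    (hL : ∀ (M : Type u) [AddCommGroup M] [Module R M] [Module.Finite R M], ∀ i, e < i →
      LZ p (EX R i M R)) (M : Type u) [AddCommGroup M] [Module R M] [Module.Finite R M]
    (h : GLZ p M) : GLZ p (M →ₗ[R] R) := fun i => GLZ.dual hL e M h i (by omega)

theorem bidual_coker [IsNoetherianRing R] {p : Ideal R} [p.IsPrime] {e : ℕ}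
    (hL : ∀ (M : Type u) [AddCommGroup M] [Module R M] [Module.Finite R M], ∀ i, e < i →
      LZ p (EX R i M R)) (M : Type u) [AddCommGroup M] [Module R M] [Module.Finite R M]
    (h : GLZ p M) (y : (M →ₗ[R] R) →ₗ[R] R) : ∃ s, s ∉ p ∧ ∃ m : M, s • y = Module.Dual.eval R M m := by
  obtain ⟨F, _, _, hF1, hF2, π, hπ⟩ := Module.exists_finite_presentation R M
  have hI := GLZ.im π hπ h 0 (GLZ.dual' hL _ (h.ker π hπ) 0)
  obtain ⟨x, hx⟩ := EX_extend (A := M →ₗ[R] R) (B := F →ₗ[R] R) (C := imK π) (f := π.dualMap) (g := (resK π).rangeRestrict) 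
      (dual_inj π hπ) (LinearMap.surjective_rangeRestrict _) (dual_exact π hπ) y
  obtain ⟨s, hs, h1⟩ := hI x
  obtain ⟨k, hk⟩ := hx s h1
  obtain ⟨f, hf⟩ := (Module.bijective_dual_eval R F).2 k
  refine ⟨s, hs, π f, ?_⟩
  rw [← hk, ← hf]
  rfl

theorem bidual_ker [IsNoetherianRing R] {p : Ideal R} [hp : p.IsPrime] {e : ℕ}
    (hL : ∀ (M : Type u) [AddCommGroup M] [Module R M] [Module.Finite R M], ∀ i, e < i →
      LZ p (EX R i M R)) (M : Type u) [AddCommGroup M] [Module R M] [Module.Finite R M]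
    (h : GLZ p M) (m : M) (hm : Module.Dual.eval R M m = 0) : ∃ s, s ∉ p ∧ s • m = 0 := by
  obtain ⟨F, _, _, hF1, hF2, π, hπ⟩ := Module.exists_finite_presentation R M
  obtain ⟨f, rfl⟩ := hπ m
  obtain ⟨l, hl⟩ := descend (B := F →ₗ[R] R) (C := imK π) (resK π).rangeRestrict (LinearMap.surjective_rangeRestrict _)
    (Module.Dual.eval R F f) (fun φ hφ => by
      obtain ⟨ψ, rfl⟩ := (dual_exact π hπ φ).1 hφ
      exact LinearMap.congr_fun hm ψ)
  obtain ⟨x, hx⟩ := EX_extend (A := imK π) (B := LinearMap.ker π →ₗ[R] R) (f := (imK π).subtype) (g := (imK π).mkQ)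
    (Submodule.subtype_injective _) (Submodule.mkQ_surjective _) (LinearMap.exact_subtype_mkQ _) l
  obtain ⟨s, hs, h2⟩ := LZ.unif0 (coker_LZ π hπ (h 0))
  obtain ⟨k, hk⟩ := hx s (EX_kill h2 _ x)
  obtain ⟨t, ht, κ, hκ⟩ := bidual_coker hL _ (h.ker π hπ) k
  have h3 : (t * s) • f = κ.1 := by
    apply (Module.bijective_dual_eval R F).1
    ext φ
    have e1 := hl φ
    have e2 := LinearMap.congr_fun hk ((resK π).rangeRestrict φ)
    have e3 := LinearMap.congr_fun hκ (resK π φ)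
    simp only [LinearMap.comp_apply, LinearMap.smul_apply, Submodule.subtype_apply, smul_eq_mul] at e2 e3
    rw [e1] at e2
    rw [map_smul, LinearMap.smul_apply, smul_eq_mul, mul_assoc, ← e2]
    exact e3
  refine ⟨t * s, fun hmem => (hp.mem_or_mem hmem).elim ht hs, ?_⟩
  rw [← map_smul, h3]
  exact κ.2

variable [IsNoetherianRing R] [IsLocalRing R]

theorem finlen_zero (d : ℕ) (ω : Type u) [AddCommGroup ω] [Module R ω] (hω : IsCanonicalModule R d ω)
    (L : Type u) [AddCommGroup L] [Module R L] [Module.Finite R L]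
    (hL : ∀ (p : Ideal R) (_ : p.IsPrime), p ≠ maximalIdeal R → LZ p L) (i : ℕ) (hi : i < d)
    (x : EX R i L ω) : x = 0 := by
  have := hω.1
  refine L3 d ω (fun i hi => ext_zero_of_subsingleton_extMod _ _ _ i (hω.2.1 i (by omega))) 0
      L ?_ i (by omega) x
  intro q hq
  have hqm : q.1 = maximalIdeal R := by
    by_contra hne
    have := q.2
    obtain ⟨s, hs, h1⟩ := LZ.unif0 (hL q.1 q.2 hne)
    exact hs (hq (Module.mem_annihilator.2 h1))
  have : Order.coheight q = 0 := by
    rw [Order.coheight_eq_zero]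
    intro q' hq'
    change q'.1 ≤ q.1
    rw [hqm]
    exact le_maximalIdeal q'.2.ne_top
  simp [this]

theorem high_zero (d : ℕ) (ω : Type u) [AddCommGroup ω] [Module R ω] (hω : IsCanonicalModule R d ω)
    (L : Type u) [AddCommGroup L] [Module R L] [Module.Finite R L] (i : ℕ) (hi : d < i)
    (x : EX R i L ω) : x = 0 := by
  have := hω.1
  refine (L1 (maximalIdeal R) ω d (fun i hi => ?_) L i hi).zero x
  exact LZ.of_subsingleton' (ext_zero_of_subsingleton_extMod _ _ _ i (hω.2.1 i (by omega)))

theorem sub_top_zero (d : ℕ) (ω : Type u) [AddCommGroup ω] [Module R ω] (hω : IsCanonicalModule R d ω)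
    {A B : Type u} [AddCommGroup A] [Module R A] [AddCommGroup B] [Module R B] [Module.Projective R B]
    [Module.Finite R B] (f : A →ₗ[R] B) (hf : Function.Injective f) (j : ℕ) (hj : d ≤ j + 1)
    (x : EX R (j+1) A ω) : x = 0 := by
  obtain ⟨δ, hδ⟩ := EX_shift ω (f := f) (g := (LinearMap.range f).mkQ) hf
    (Submodule.mkQ_surjective _) (LinearMap.exact_map_mkQ_range _) j
  apply hδ
  exact high_zero d ω hω _ _ (by omega) _

theorem dual_top_zero (d : ℕ) (ω : Type u) [AddCommGroup ω] [Module R ω] (hω : IsCanonicalModule R d ω)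
    (N : Type u) [AddCommGroup N] [Module R N] [Module.Finite R N] (j : ℕ) (hj : d ≤ j + 2)
    (x : EX R (j+1) (N →ₗ[R] R) ω) : x = 0 := by
  obtain ⟨F, _, _, hF1, hF2, π, hπ⟩ := Module.exists_finite_presentation R N
  obtain ⟨δ, hδ⟩ := EX_shift ω (A := N →ₗ[R] R) (B := F →ₗ[R] R) (C := imK π) (f := π.dualMap) (g := (resK π).rangeRestrict) 
      (dual_inj π hπ) (LinearMap.surjective_rangeRestrict _) (dual_exact π hπ) j
  apply hδ
  obtain ⟨G, _, _, hG1, hG2, τ, hτ⟩ := Module.exists_finite_presentation R (LinearMap.ker π)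
  exact sub_top_zero d ω hω (A := imK π) (B := G →ₗ[R] R) (τ.dualMap ∘ₗ (imK π).subtype)
    ((dual_inj τ hτ).comp (Submodule.subtype_injective _)) (j+1) (by omega) _

theorem chain (d : ℕ) (ω : Type u) [AddCommGroup ω] [Module R ω] (hω : IsCanonicalModule R d ω)
    (r : R) (n : ℕ) (m : ℕ) (hd : d = (n + 1) + (m + 1)) 
    (N : Type u) [AddCommGroup N] [Module R N] [Module.Finite R N]
    (hN : ∀ (p : Ideal R) (_ : p.IsPrime), p ≠ maximalIdeal R → GLZ p N)
    (hr : ∀ x : EX R (n+1) N R, r • x = 0) 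
    (G : Type u) [AddCommGroup G] [Module R G] [Module.Free R G] [Module.Finite R G]
    (π : G →ₗ[R] N) (hπ : Function.Surjective π) (x : EX R (m+1) (imK π) ω) : r • x = 0 := by
  obtain ⟨δ, -, h1, -⟩ := EX_contra ω (A := imK π) (B := LinearMap.ker π →ₗ[R] R) (f := (imK π).subtype) (g := (imK π).mkQ)
    (Submodule.subtype_injective _) (Submodule.mkQ_surjective _) (LinearMap.exact_subtype_mkQ _) (m+1)
  induction n generalizing m N G with
  | zero =>
    have hE : ∀ y : (LinearMap.ker π →ₗ[R] R) ⧸ imK π, r • y = 0 := by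
      intro y
      obtain ⟨y, rfl⟩ := Submodule.mkQ_surjective _ y
      obtain ⟨x, hx⟩ := ext1_kill π hπ y
      rw [← map_smul, Submodule.mkQ_apply, Submodule.Quotient.mk_eq_zero]
      exact hx r (hr x)
    obtain ⟨y, hy⟩ := (h1 (r • x)).1 (by rw [map_smul]; exact EX_kill hE _ _)
    rw [← hy, dual_top_zero d ω hω _ m (by omega) y, map_zero]
  | succ n IH =>
    obtain ⟨y, rfl⟩ := (h1 x).1 (finlen_zero d ω hω _ 
      (fun p hp hpm => coker_LZ π hπ (hN p hp hpm 0)) _ (by omega) _)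
    rw [← map_smul]
    suffices hy : r • y = 0 by rw [hy, map_zero]
    obtain ⟨G', _, _, hG1, hG2, τ, hτ⟩ := Module.exists_finite_presentation R (LinearMap.ker π)
    obtain ⟨δ', hδ'⟩ := EX_shift ω (A := (LinearMap.ker π) →ₗ[R] R) (B := G' →ₗ[R] R) (C := imK τ) (f := τ.dualMap) (g := (resK τ).rangeRestrict) 
      (dual_inj τ hτ) (LinearMap.surjective_rangeRestrict _) (dual_exact τ hτ) m
    apply hδ'
    rw [map_smul]
    obtain ⟨δ2, -, h2, -⟩ := EX_contra ω (A := imK τ) (B := LinearMap.ker τ →ₗ[R] R) (f := (imK τ).subtype) (g := (imK τ).mkQ)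
      (Submodule.subtype_injective _) (Submodule.mkQ_surjective _) (LinearMap.exact_subtype_mkQ _) (m+1+1)
    refine IH (m+1) (by omega) (LinearMap.ker π) (fun p hp hpm => (hN p hp hpm).ker π hπ) ?_ G' τ hτ _ δ2 h2
    intro z
    obtain ⟨ε, hε⟩ := EX_shift R (f := (LinearMap.ker π).subtype) (g := π) 
      (Submodule.subtype_injective _) hπ (LinearMap.exact_subtype_ker_map _) n
    apply hε
    rw [map_smul]
    exact hr _

theorem retract (d : ℕ) (hd2 : 2 ≤ d) (ω : Type u) [AddCommGroup ω] [Module R ω] (hω : IsCanonicalModule R d ω)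
    (hgor : ∀ (p : Ideal R) (_ : p.IsPrime), p ≠ maximalIdeal R → 
      (∃ e : ℕ, ∀ (M : Type u) [AddCommGroup M] [Module R M] [Module.Finite R M], ∀ i, e < i →
      LZ p (EX R i M R)) ∧ GLZ p ω) :
    ∃ φ : ((ω →ₗ[R] R) →ₗ[R] R) →ₗ[R] ω, φ ∘ₗ Module.Dual.eval R ω = LinearMap.id := by
  have := hω.1
  have hinj : Function.Injective (Module.Dual.eval R ω) := by
    rw [← LinearMap.ker_eq_bot, Submodule.eq_bot_iff]
    intro x hx
    have h0 := finlen_zero d ω hω (LinearMap.ker (Module.Dual.eval R ω)) (fun p hp hpm y => by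
      obtain ⟨⟨e, he⟩, hG⟩ := hgor p hp hpm
      obtain ⟨s, hs, h1⟩ := bidual_ker he ω hG y.1 y.2
      exact ⟨s, hs, Subtype.ext h1⟩) 0 (by omega) ((EXzero _ _).symm (Submodule.subtype _))
    have h1 : (LinearMap.ker (Module.Dual.eval R ω)).subtype = 0 := by
      apply (EXzero _ _).symm.injective
      rw [h0, map_zero]
    exact LinearMap.congr_fun h1 ⟨x, hx⟩
  obtain ⟨x, hx⟩ := EX_extend (A := ω) (B := (ω →ₗ[R] R) →ₗ[R] R) 
    (C := ((ω →ₗ[R] R) →ₗ[R] R) ⧸ LinearMap.range (Module.Dual.eval R ω))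
    (f := Module.Dual.eval R ω) (g := (LinearMap.range (Module.Dual.eval R ω)).mkQ) hinj
    (Submodule.mkQ_surjective _) (LinearMap.exact_map_mkQ_range _) LinearMap.id
  obtain ⟨φ, hφ⟩ := hx 1 (by
    rw [finlen_zero d ω hω _ (fun p hp hpm y => by
      obtain ⟨⟨e, he⟩, hG⟩ := hgor p hp hpm
      obtain ⟨y, rfl⟩ := Submodule.mkQ_surjective _ y
      obtain ⟨s, hs, m, h1⟩ := bidual_coker he ω hG y
      refine ⟨s, hs, ?_⟩
      rw [← map_smul, Submodule.mkQ_apply, Submodule.Quotient.mk_eq_zero, h1]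
      exact ⟨m, rfl⟩) 1 (by omega) x, smul_zero])
  exact ⟨φ, by rw [hφ, one_smul]⟩

end


section
variable {R}

theorem stable_factor {M S : Type u} [AddCommGroup M] [Module R M] [AddCommGroup S] [Module R S]
    (hS : IsSyzygy R M S) {r : R} (hr : r ∈ extAnn R 1 M S) :
    ∃ (F : Type u) (_ : AddCommGroup F) (_ : Module R F) (a : M →ₗ[R] F) (b : F →ₗ[R] M),
      Module.Free R F ∧ Module.Finite R F ∧ b ∘ₗ a = r • LinearMap.id := by
  obtain ⟨F, _, _, ι, π, hF1, hF2, hι, hπ, hr1⟩ := hS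
  have hex : Function.Exact ι π := LinearMap.exact_iff.2 hr1.symm
  obtain ⟨x, hx⟩ := EX_extend (N := S) hι hπ hex LinearMap.id
  obtain ⟨k, hk⟩ := hx r ((mem_extAnn_succ R M S 0 r).1 hr x)
  obtain ⟨l, hl⟩ := descend π hπ (r • LinearMap.id - ι ∘ₗ k) (fun b hb => by
    obtain ⟨s, rfl⟩ := (hex b).1 hb
    have := LinearMap.congr_fun hk s
    simp only [LinearMap.comp_apply, LinearMap.smul_apply, LinearMap.id_apply] at this
    simp [this])
  refine ⟨F, _, _, l, π, hF1, hF2, ?_⟩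
  ext m
  obtain ⟨f, rfl⟩ := hπ m
  simp [hl, hex.apply_apply_eq_zero]

theorem factor_kill {M F : Type u} [AddCommGroup M] [Module R M] [AddCommGroup F] [Module R F]
    [Module.Projective R F] {r : R} (a : M →ₗ[R] F) (b : F →ₗ[R] M) (h : b ∘ₗ a = r • LinearMap.id)
    (N : Type u) [AddCommGroup N] [Module R N] (i : ℕ) : r ∈ extAnn R (i+1) M N := by
  rw [mem_extAnn_succ]
  intro x
  have h1 : r • x = EXpre N (r • LinearMap.id) (i+1) x := by rw [EXpre_smul, EXpre_id]
  rw [h1, ← h, ← EXpre_comp, EX_proj i (EXpre N b (i+1) x), map_zero]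

theorem kill_snd {M A B : Type u} [AddCommGroup M] [Module R M] [AddCommGroup A] [Module R A]
    [AddCommGroup B] [Module R B] {r : R} {i : ℕ} (h : r ∈ extAnn R (i+1) M (A × B))
    (x : EX R (i+1) M B) : r • x = 0 := by
  rw [mem_extAnn_succ] at h
  have h1 : EXpost M (LinearMap.snd R A B) (i+1) (EXpost M (LinearMap.inr R A B) (i+1) x) = x := by
    rw [EXpost_comp, LinearMap.snd_comp_inr, EXpost_id]
  rw [← h1, ← map_smul, h, map_zero]

theorem main_incl [IsNoetherianRing R] [IsLocalRing R]
    (d : ℕ) (hd : 2 ≤ d) (hdim : ringKrullDim R = (d : ℕ))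
    (ω : Type u) [AddCommGroup ω] [Module R ω] (hω : IsCanonicalModule R d ω)
    (hpunct : ∀ (p : Ideal R) (hp : p.IsPrime), p ≠ maximalIdeal R →
      IsGorensteinLocal (Localization.AtPrime p)) (r : R)
    (hr : ∀ x : EX R (d - 2 + 1) (ω →ₗ[R] R) R, r • x = 0) (Sω : Type u) [AddCommGroup Sω] [Module R Sω] :
    r ∈ extAnn R 1 ω Sω := by
  have := hω.1
  have hgor : ∀ (p : Ideal R) (_ : p.IsPrime), p ≠ maximalIdeal R → 
      (∃ e : ℕ, ∀ (M : Type u) [AddCommGroup M] [Module R M] [Module.Finite R M], ∀ i, e < i →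
      LZ p (EX R i M R)) ∧ GLZ p ω := by
    intro p hp hpm
    obtain ⟨h1, h2⟩ := LZ_omega d hdim ω hω p (hpunct p hp hpm)
    exact ⟨h1, fun j => h2 (j+1) (by omega)⟩
  have hN : ∀ (p : Ideal R) (_ : p.IsPrime), p ≠ maximalIdeal R → GLZ p (ω →ₗ[R] R) := by
    intro p hp hpm
    obtain ⟨⟨e, h1⟩, h2⟩ := hgor p hp hpm
    exact GLZ.dual' h1 ω h2
  obtain ⟨φ, hφ⟩ := retract d hd ω hω hgor
  obtain ⟨G, _, _, hG1, hG2, π, hπ⟩ := Module.exists_finite_presentation R (ω →ₗ[R] R)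
  obtain ⟨x, hx⟩ := EX_extend (A := (ω →ₗ[R] R) →ₗ[R] R) (B := G →ₗ[R] R) (C := imK π)
    (f := π.dualMap) (g := (resK π).rangeRestrict) 
    (dual_inj π hπ) (LinearMap.surjective_rangeRestrict _) (dual_exact π hπ) φ
  obtain ⟨ψ, hψ⟩ := hx r (chain d ω hω r (d-2) 0 (by omega) _ hN hr G π hπ x)
  refine factor_kill (F := G →ₗ[R] R) (π.dualMap ∘ₗ Module.Dual.eval R ω) ψ ?_ Sω 0
  rw [← LinearMap.comp_assoc, hψ, LinearMap.smul_comp, hφ]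

end

/-- For a Cohen–Macaulay local ring of dimension `d ≥ 2` with canonical module `ω`,
Gorenstein on the punctured spectrum, the stable annihilator of `ω* = Hom(ω, R)`
equals its Auslander–Reiten annihilator, and both equal the stable annihilator
of `ω`. -/
theorem stmt15 (R : Type u) [CommRing R] [IsNoetherianRing R] [IsLocalRing R]
    (d : ℕ) (hd : 2 ≤ d) (hdim : ringKrullDim R = (d : ℕ))
    (hCM : moduleDepth R R = (d : ℕ∞))
    (ω : Type u) [AddCommGroup ω] [Module R ω] (hω : IsCanonicalModule R d ω)
    (hpunct : ∀ (p : Ideal R) (hp : p.IsPrime), p ≠ maximalIdeal R →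
      IsGorensteinLocal (Localization.AtPrime p))
    (S Sω : Type u) [AddCommGroup S] [Module R S] [AddCommGroup Sω] [Module R Sω]
    (hS : IsSyzygy R (ω →ₗ[R] R) S) (hSω : IsSyzygy R ω Sω) :
    extAnn R 1 (ω →ₗ[R] R) S = ARann R (ω →ₗ[R] R) ∧
      extAnn R 1 (ω →ₗ[R] R) S = extAnn R 1 ω Sω := by
  have h1 : extAnn R 1 ω Sω ≤ extAnn R 1 (ω →ₗ[R] R) S := by
    intro r hr
    obtain ⟨F, _, _, a, b, hF1, hF2, hab⟩ := stable_factor hSω hr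
    refine factor_kill (F := F →ₗ[R] R) b.dualMap a.dualMap ?_ S 0
    ext φ m
    have := LinearMap.congr_fun hab m
    simp only [LinearMap.comp_apply, LinearMap.smul_apply, LinearMap.id_apply] at this
    change φ (b (a m)) = _
    simp [this]
  have h2 : extAnn R 1 (ω →ₗ[R] R) S ≤ ARann R (ω →ₗ[R] R) := by
    intro r hr
    obtain ⟨F, _, _, a, b, hF1, hF2, hab⟩ := stable_factor hS hr
    rw [ARann, Ideal.mem_iInf]
    exact fun i => factor_kill a b hab _ i
  have h3 : ARann R (ω →ₗ[R] R) ≤ extAnn R 1 ω Sω := by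
    intro r hr
    rw [ARann, Ideal.mem_iInf] at hr
    exact main_incl d hd hdim ω hω hpunct r (kill_snd (hr (d-2))) Sω
  exact ⟨le_antisymm h2 (h3.trans h1), le_antisymm (h2.trans h3) h1⟩
end

section
/- Let R be a Gorenstein local ring of Krull dimension d ≥ 2 and M a maximal Cohen–Macaulay R-module which is free on the punctured spectrum. Then the Auslander–Reiten annihilator of M equals the stable annihilator of M: ⋂_{i>0} ann_R Ext^i_R(M, M ⊕ R) = ann_R Ext^1_R(M, ΩM). -/
open CategoryTheory Opposite IsLocalRing

universe u

variable (R : Type u) [CommRing R]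

section Bridge

variable {R}

/-- `r` kills `Ext^i(N, X)`. -/
def Kills (r : R) (i : ℕ) (N X : Type u) [AddCommGroup N] [Module R N]
    [AddCommGroup X] [Module R X] : Prop :=
  ∀ e : Abelian.Ext.{u} (ModuleCat.of R N) (ModuleCat.of R X) i, r • e = 0

theorem homology_kills (S : ShortComplex (ModuleCat.{u} R)) (r : R) :
    r ∈ Module.annihilator R S.homology ↔
      ∀ x : S.X₂, S.g x = 0 → ∃ y : S.X₁, S.f y = r • x := by
  rw [(S.moduleCatHomologyIso.toLinearEquiv).annihilator_eq, Module.mem_annihilator]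
  constructor
  · intro h x hx
    have h1 := h (Submodule.Quotient.mk ⟨x, hx⟩)
    erw [← Submodule.Quotient.mk_smul, Submodule.Quotient.mk_eq_zero] at h1
    obtain ⟨y, hy⟩ := h1
    exact ⟨y, congrArg Subtype.val hy⟩
  · intro h m
    obtain ⟨⟨x, hx⟩, rfl⟩ := Submodule.Quotient.mk_surjective _ m
    erw [← Submodule.Quotient.mk_smul, Submodule.Quotient.mk_eq_zero]
    obtain ⟨y, hy⟩ := h x hx
    exact ⟨y, Subtype.ext hy⟩

theorem mem_extAnn_iff_res (r : R) (i j k : ℕ) (hi : (ComplexShape.up ℕ).prev j = i)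
    (hk : (ComplexShape.up ℕ).next j = k) (N X : Type u) [AddCommGroup N]
    [Module R N] [AddCommGroup X] [Module R X] (P : ProjectiveResolution (ModuleCat.of R N)) :
    r ∈ extAnn R j N X ↔ ∀ f : P.complex.X j ⟶ ModuleCat.of R X, P.complex.d k j ≫ f = 0 →
      ∃ g : P.complex.X i ⟶ ModuleCat.of R X, P.complex.d j i ≫ g = r • f := by
  unfold extAnn ExtMod
  rw [((P.isoExt j (ModuleCat.of R X)) ≪≫ (ShortComplex.homologyMapIso
    ((P.complex.linearYonedaObj R (ModuleCat.of R X)).isoSc' i j k hi hk))).toLinearEquiv.annihilator_eq,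
    homology_kills]
  exact Iff.rfl

theorem smul_extMk {X Y : ModuleCat.{u} R} (P : ProjectiveResolution X) {n : ℕ} (r : R)
    (f : P.complex.X n ⟶ Y) (m : ℕ) (hm : n + 1 = m) (hf : P.complex.d m n ≫ f = 0) :
    r • P.extMk f m hm hf = P.extMk (r • f) m hm (by simp [hf]) := by
  rw [Abelian.Ext.smul_eq_comp_mk₀, ProjectiveResolution.extMk_comp_mk₀]
  congr 1

theorem mem_extAnn_iff (r : R) (i : ℕ) (N X : Type u) [AddCommGroup N]
    [Module R N] [AddCommGroup X] [Module R X] :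
    r ∈ extAnn R (i + 1) N X ↔ Kills r (i + 1) N X := by
  let P := projectiveResolution (ModuleCat.of R N)
  rw [mem_extAnn_iff_res r i (i + 1) (i + 2) (by simp) (by simp) N X P]
  constructor
  · intro h e
    obtain ⟨f, hf, rfl⟩ := P.extMk_surjective e (i + 2) rfl
    rw [smul_extMk, P.extMk_eq_zero_iff _ _ _ _ i rfl]
    exact h f hf
  · intro h f hf
    have := h (P.extMk f (i + 2) rfl hf)
    rwa [smul_extMk, P.extMk_eq_zero_iff _ _ _ _ i rfl] at this

theorem hom_eq_zero_of_ext_zero (N X : Type u) [AddCommGroup N]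
    [Module R N] [AddCommGroup X] [Module R X] (h : Subsingleton (ExtMod R 0 N X))
    (φ : N →ₗ[R] X) : φ = 0 := by
  let P := projectiveResolution (ModuleCat.of R N)
  have h1 : (1 : R) ∈ extAnn R 0 N X := by
    rw [extAnn, Module.mem_annihilator]
    intro m
    exact Subsingleton.elim _ _
  rw [mem_extAnn_iff_res 1 0 0 1 (by simp) (by simp) N X P] at h1
  obtain ⟨g, hg⟩ := h1 (P.π.f 0 ≫ (HomologicalComplex.singleObjXSelf _ _ _).hom ≫ ModuleCat.ofHom φ)
    (by rw [← Category.assoc, ProjectiveResolution.complex_d_comp_π_f_zero, Limits.zero_comp])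
  have h2 : P.complex.d 0 0 = 0 := P.complex.shape _ _ (by simp)
  rw [h2, Limits.zero_comp, one_smul] at hg
  have h3 := (cancel_epi (P.π.f 0)).1 (hg.symm.trans (Limits.comp_zero).symm)
  have h4 := (cancel_epi (HomologicalComplex.singleObjXSelf _ _ _).hom).1
    (h3.trans (Limits.comp_zero).symm)
  exact ModuleCat.hom_ext_iff.1 h4

theorem kills_zero_iff (r : R) (N X : Type u) [AddCommGroup N]
    [Module R N] [AddCommGroup X] [Module R X] :
    Kills r 0 N X ↔ ∀ φ : N →ₗ[R] X, r • φ = 0 := by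
  constructor
  · intro h φ
    have := h (Abelian.Ext.mk₀ (ModuleCat.ofHom φ))
    rw [← Abelian.Ext.mk₀_smul, Abelian.Ext.mk₀_eq_zero_iff] at this
    exact ModuleCat.hom_ext_iff.1 this
  · intro h e
    obtain ⟨φ, rfl⟩ := (Abelian.Ext.mk₀_bijective _ _).2 e
    rw [← Abelian.Ext.mk₀_smul, Abelian.Ext.mk₀_eq_zero_iff]
    exact ModuleCat.hom_ext (h φ.hom)

end Bridge

section Les

variable {R}
variable {A B C X : Type u} [AddCommGroup A] [Module R A] [AddCommGroup B] [Module R B]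
  [AddCommGroup C] [Module R C] [AddCommGroup X] [Module R X]

theorem Kills.of_one {i : ℕ} (h : Kills (1 : R) i A X) (r : R) : Kills r i A X := by
  intro e
  have := h e
  rw [one_smul] at this
  rw [this, smul_zero]

theorem Kills.eq_zero {i : ℕ} (h : Kills (1 : R) i A X)
    (e : Abelian.Ext.{u} (ModuleCat.of R A) (ModuleCat.of R X) i) : e = 0 := by
  rw [← one_smul R e]
  exact h e

theorem kills_free [Module.Free R A] (i : ℕ) (r : R) : Kills r (i + 1) A X := by
  intro e
  have : Projective (ModuleCat.of R A) := ModuleCat.projective_of_free (Module.Free.chooseBasis R A)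
  rw [Abelian.Ext.eq_zero_of_projective e, smul_zero]

/-- precomposition with a linear map -/
noncomputable def pre (f : A →ₗ[R] B) {i : ℕ}
    (e : Abelian.Ext.{u} (ModuleCat.of R B) (ModuleCat.of R X) i) :
    Abelian.Ext.{u} (ModuleCat.of R A) (ModuleCat.of R X) i :=
  (Abelian.Ext.mk₀ (ModuleCat.ofHom f)).comp e (zero_add i)

theorem pre_pre (f : A →ₗ[R] B) (g : B →ₗ[R] C) {i : ℕ}
    (e : Abelian.Ext.{u} (ModuleCat.of R C) (ModuleCat.of R X) i) :
    pre f (pre g e) = pre (g ∘ₗ f) e := by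
  simp [pre, ModuleCat.ofHom_comp]

theorem pre_smul_id (r : R) {i : ℕ}
    (e : Abelian.Ext.{u} (ModuleCat.of R A) (ModuleCat.of R X) i) :
    pre (r • LinearMap.id) e = r • e := by
  have : ModuleCat.ofHom (r • (LinearMap.id : A →ₗ[R] A)) = r • 𝟙 (ModuleCat.of R A) := rfl
  rw [pre, this, Abelian.Ext.mk₀_smul]
  simp

theorem pre_smul (f : A →ₗ[R] B) (r : R) {i : ℕ}
    (e : Abelian.Ext.{u} (ModuleCat.of R B) (ModuleCat.of R X) i) :
    pre f (r • e) = r • pre f e := by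
  simp [pre]

theorem pre_zero (f : A →ₗ[R] B) {i : ℕ} :
    pre f (0 : Abelian.Ext.{u} (ModuleCat.of R B) (ModuleCat.of R X) i) = 0 := by
  simp [pre]

theorem Kills.of_equiv (l : A ≃ₗ[R] B) {i : ℕ} {r : R} (h : Kills r i A X) : Kills r i B X := by
  intro e
  have h1 : pre (r • LinearMap.id) e = pre l.symm.toLinearMap (r • pre l.toLinearMap e) := by
    rw [pre_smul, pre_pre]
    rw [pre_smul_id]
    congr 1
    have : l.toLinearMap ∘ₗ l.symm.toLinearMap = (1 : R) • LinearMap.id := by ext; simp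
    rw [this, pre_smul_id, one_smul]
  rw [← pre_smul_id, h1, h, pre_zero]

/-- if `r • id` factors through a module with vanishing Ext, `r` kills Ext -/
theorem Kills.of_factor {r : R} (g : A →ₗ[R] B) (h : B →ₗ[R] A)
    (hgh : h ∘ₗ g = r • LinearMap.id) {i : ℕ} (hB : Kills (1 : R) i B X) : Kills r i A X := by
  intro e
  rw [← pre_smul_id, ← hgh, ← pre_pre, hB.eq_zero (pre h e), pre_zero]

/-- short exact sequences of modules -/
structure Ses (f : A →ₗ[R] B) (g : B →ₗ[R] C) : Prop where
  inj : Function.Injective f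
  surj : Function.Surjective g
  exact : Function.Exact f g

theorem ses_ker (g : B →ₗ[R] C) (hg : Function.Surjective g) :
    Ses (LinearMap.ker g).subtype g :=
  ⟨Subtype.val_injective, hg, LinearMap.exact_subtype_ker_map g⟩

theorem ses_quot (N : Submodule R B) : Ses N.subtype N.mkQ :=
  ⟨Subtype.val_injective, N.mkQ_surjective, LinearMap.exact_subtype_mkQ N⟩

theorem ses_inj (f : A →ₗ[R] B) (hf : Function.Injective f) :
    Ses f (LinearMap.range f).mkQ :=
  ⟨hf, Submodule.mkQ_surjective _, LinearMap.exact_map_mkQ_range f⟩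

variable {f : A →ₗ[R] B} {g : B →ₗ[R] C}

/-- the associated short complex -/
noncomputable def Ses.sc (h : Ses f g) : ShortComplex (ModuleCat.{u} R) :=
  ShortComplex.mk (ModuleCat.ofHom f) (ModuleCat.ofHom g)
    (by rw [← ModuleCat.ofHom_comp, h.exact.linearMap_comp_eq_zero]; rfl)

theorem Ses.shortExact (h : Ses f g) : h.sc.ShortExact where
  exact := (ShortComplex.ShortExact.moduleCat_exact_iff_function_exact _).mpr h.exact
  mono_f := (ModuleCat.mono_iff_injective _).mpr h.inj
  epi_g := (ModuleCat.epi_iff_surjective _).mpr h.surj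

/-- connecting map -/
noncomputable def Ses.δ (h : Ses f g) {i : ℕ}
    (e : Abelian.Ext.{u} (ModuleCat.of R A) (ModuleCat.of R X) i) :
    Abelian.Ext.{u} (ModuleCat.of R C) (ModuleCat.of R X) (i + 1) :=
  h.shortExact.extClass.comp e (add_comm 1 i)

theorem Ses.δ_smul (h : Ses f g) {i : ℕ} (r : R)
    (e : Abelian.Ext.{u} (ModuleCat.of R A) (ModuleCat.of R X) i) :
    h.δ (r • e) = r • h.δ e :=
  Abelian.Ext.comp_smul h.shortExact.extClass e _ r

theorem Ses.δ_zero (h : Ses f g) {i : ℕ} :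
    h.δ (0 : Abelian.Ext.{u} (ModuleCat.of R A) (ModuleCat.of R X) i) = 0 :=
  Abelian.Ext.comp_zero h.shortExact.extClass _ _ _ _

theorem Ses.exact₁ (h : Ses f g) {i : ℕ}
    (e : Abelian.Ext.{u} (ModuleCat.of R A) (ModuleCat.of R X) i) (he : h.δ e = 0) :
    ∃ y, pre f y = e :=
  Abelian.Ext.contravariant_sequence_exact₁ h.shortExact _ e _ he

theorem Ses.exact₂ (h : Ses f g) {i : ℕ}
    (e : Abelian.Ext.{u} (ModuleCat.of R B) (ModuleCat.of R X) i) (he : pre f e = 0) :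
    ∃ y, pre g y = e :=
  Abelian.Ext.contravariant_sequence_exact₂ h.shortExact _ e he

theorem Ses.exact₃ (h : Ses f g) {i : ℕ}
    (e : Abelian.Ext.{u} (ModuleCat.of R C) (ModuleCat.of R X) (i + 1)) (he : pre g e = 0) :
    ∃ y, h.δ y = e :=
  Abelian.Ext.contravariant_sequence_exact₃ h.shortExact _ e he _

theorem Ses.δ_surj (h : Ses f g) {i : ℕ} (hB : Kills (1 : R) (i + 1) B X)
    (e : Abelian.Ext.{u} (ModuleCat.of R C) (ModuleCat.of R X) (i + 1)) :
    ∃ y, h.δ y = e := h.exact₃ e (hB.eq_zero _)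

theorem Ses.kills_right (h : Ses f g) {i : ℕ} {r : R} (hA : Kills r i A X)
    (hB : Kills (1 : R) (i + 1) B X) : Kills r (i + 1) C X := by
  intro e
  obtain ⟨y, rfl⟩ := h.δ_surj hB e
  rw [← h.δ_smul, hA, h.δ_zero]

theorem Ses.pre_inj (h : Ses f g) {i : ℕ} (hA : Kills (1 : R) i A X)
    (e : Abelian.Ext.{u} (ModuleCat.of R C) (ModuleCat.of R X) (i + 1)) (he : pre g e = 0) :
    e = 0 := by
  obtain ⟨y, rfl⟩ := h.exact₃ e he
  rw [hA.eq_zero y, h.δ_zero]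

theorem Ses.kills_right' (h : Ses f g) {i : ℕ} {r : R} (hA : Kills (1 : R) i A X)
    (hB : Kills r (i + 1) B X) : Kills r (i + 1) C X := by
  intro e
  apply h.pre_inj hA
  rw [pre_smul, hB]

theorem Ses.kills_mid (h : Ses f g) {i : ℕ} (hA : Kills (1 : R) i A X)
    (hC : Kills (1 : R) i C X) : Kills (1 : R) i B X := by
  intro e
  obtain ⟨y, rfl⟩ := h.exact₂ e (hA.eq_zero _)
  rw [hC.eq_zero y, pre_zero, smul_zero]

theorem Ses.pre_surj (h : Ses f g) {i : ℕ} (hC : Kills (1 : R) (i + 1) C X)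
    (e : Abelian.Ext.{u} (ModuleCat.of R A) (ModuleCat.of R X) i) : ∃ y, pre f y = e :=
  h.exact₁ e (hC.eq_zero _)

theorem Ses.kills_left (h : Ses f g) {i : ℕ} (hB : Kills (1 : R) i B X)
    {r : R} (hC : Kills r (i + 1) C X) : Kills r i A X := by
  intro e
  obtain ⟨y, hy⟩ := h.exact₁ (r • e) (by rw [h.δ_smul, hC])
  rw [← hy, hB.eq_zero y, pre_zero]

theorem pre_mk₀ (f : A →ₗ[R] B) (φ : B →ₗ[R] X) :
    pre f (Abelian.Ext.mk₀ (ModuleCat.ofHom φ)) = Abelian.Ext.mk₀ (ModuleCat.ofHom (φ ∘ₗ f)) := by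
  simp [pre, ModuleCat.ofHom_comp]

/-- concrete description of Ext^1 -/
theorem Ses.kills_one_iff (h : Ses f g) (hB : Kills (1 : R) 1 B X) (r : R) :
    Kills r 1 C X ↔ ∀ φ : A →ₗ[R] X, ∃ ψ : B →ₗ[R] X, ψ ∘ₗ f = r • φ := by
  constructor
  · intro hk φ
    obtain ⟨y, hy⟩ := h.exact₁ (r • Abelian.Ext.mk₀ (ModuleCat.ofHom φ)) (by rw [h.δ_smul, hk])
    obtain ⟨ψ, rfl⟩ := (Abelian.Ext.mk₀_bijective _ _).2 y
    refine ⟨ψ.hom, ?_⟩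
    have h2 : pre f (Abelian.Ext.mk₀ (ModuleCat.ofHom ψ.hom)) =
      r • Abelian.Ext.mk₀ (ModuleCat.ofHom φ) := hy
    rw [pre_mk₀, ← Abelian.Ext.mk₀_smul] at h2
    exact ModuleCat.hom_ext_iff.1 ((Abelian.Ext.mk₀_bijective _ _).1 h2)
  · intro hk e
    obtain ⟨y, rfl⟩ := h.δ_surj hB e
    obtain ⟨φ, rfl⟩ := (Abelian.Ext.mk₀_bijective _ _).2 y
    obtain ⟨ψ, hψ⟩ := hk φ.hom
    have h2 : r • Abelian.Ext.mk₀ φ = pre f (Abelian.Ext.mk₀ (ModuleCat.ofHom ψ)) := by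
      rw [pre_mk₀, hψ, ← Abelian.Ext.mk₀_smul]
      rfl
    rw [← h.δ_smul, h2]
    exact h.shortExact.extClass_comp_assoc _

/-- Nakayama step -/
theorem kills_of_regular [IsNoetherianRing R] [IsLocalRing R] [Module.Finite R A]
    [Module.Finite R X] (x : R) (hx : x ∈ maximalIdeal R)
    {q : A →ₗ[R] C} (h : Ses (x • (LinearMap.id : A →ₗ[R] A)) q) {i : ℕ}
    (hC : Kills (1 : R) (i + 1) C X) : Kills (1 : R) i A X := by
  have hfin : Module.Finite R (ModuleCat.of R A) := inferInstanceAs (Module.Finite R A)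
  have hfin : Module.Finite R (ModuleCat.of R X) := inferInstanceAs (Module.Finite R X)
  have htop : (⊤ : Submodule R (Abelian.Ext.{u} (ModuleCat.of R A) (ModuleCat.of R X) i)) = ⊥ := by
    apply Submodule.eq_bot_of_le_smul_of_le_jacobson_bot (maximalIdeal R) _ Module.Finite.fg_top
    · intro e _
      obtain ⟨y, rfl⟩ := h.pre_surj hC e
      rw [pre_smul_id]
      exact Submodule.smul_mem_smul hx trivial
    · exact IsLocalRing.maximalIdeal_le_jacobson _
  intro e
  have : e ∈ (⊤ : Submodule R (Abelian.Ext.{u} (ModuleCat.of R A) (ModuleCat.of R X) i)) := trivial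
  rw [htop] at this
  rw [(Submodule.mem_bot R).1 this, smul_zero]

end Les

section Gor

variable {R}

/-- working form of the Gorenstein property -/
structure GorK (R : Type u) [CommRing R] [IsLocalRing R] (d : ℕ) : Prop where
  van : ∀ i, i ≠ d → Kills (1 : R) i (ResidueField R) R
  ne : ¬ Kills (1 : R) d (ResidueField R) R

theorem gorK [IsLocalRing R] (hG : IsGorensteinLocal R) (d : ℕ) (hd : 2 ≤ d)
    (hdim : ringKrullDim R = (d : ℕ)) : GorK R d := by
  obtain ⟨-, d', hd', -, h1, ⟨h2⟩⟩ := hG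
  obtain rfl : d = d' := by
    rw [hdim] at hd'
    exact_mod_cast hd'
  constructor
  · intro i hi
    cases i with
    | zero =>
      rw [kills_zero_iff]
      intro φ
      rw [hom_eq_zero_of_ext_zero _ _ (h1 0 hi) φ, smul_zero]
    | succ i =>
      rw [← mem_extAnn_iff, extAnn, Module.mem_annihilator]
      intro m
      have := h1 _ hi
      exact Subsingleton.elim _ _
  · intro h
    obtain ⟨n, rfl⟩ : ∃ n, d = n + 1 := ⟨d - 1, by omega⟩
    rw [← mem_extAnn_iff, extAnn, h2.annihilator_eq, Module.mem_annihilator] at h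
    have := h 1
    simp at this

variable [IsNoetherianRing R] [IsLocalRing R] {d : ℕ}

theorem kills_subsingleton (N X : Type u) [AddCommGroup N] [Module R N] [AddCommGroup X]
    [Module R X] [Subsingleton N] (i : ℕ) (r : R) : Kills r i N X := by
  cases i with
  | zero =>
    rw [kills_zero_iff]
    intro φ
    ext x
    rw [Subsingleton.elim x 0]
    simp
  | succ i => exact kills_free i r

theorem ann_quot_prime {N : Type u} [AddCommGroup N] [Module R N] (p : Ideal R)
    (l : N ≃ₗ[R] R ⧸ p) : Module.annihilator R N = p := by
  rw [l.annihilator_eq, Ideal.annihilator_quotient]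

theorem GorK.torsion (hG : GorK R d) {N : Type u} [AddCommGroup N] [Module R N]
    (hN : Module.Finite R N) {i : ℕ} (hi : i < d) :
    (∃ n, maximalIdeal R ^ n ≤ Module.annihilator R N) → Kills (1 : R) i N R := by
  induction hN using IsNoetherianRing.induction_on_isQuotientEquivQuotientPrime R with
  | subsingleton N => exact fun _ => kills_subsingleton N R i 1
  | quotient N p l =>
    rintro ⟨n, hn⟩
    rw [ann_quot_prime _ l] at hn
    have hp : p.1 = maximalIdeal R :=
      le_antisymm (le_maximalIdeal p.2.ne_top) (p.2.le_of_pow_le hn)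
    obtain ⟨p, hp'⟩ := p
    dsimp at hp l
    subst hp
    exact Kills.of_equiv l.symm (hG.van i hi.ne)
  | exact N₁ N₂ N₃ f g hf hg hfg h1 h3 =>
    rintro ⟨n, hn⟩
    exact Ses.kills_mid ⟨hf, hg, hfg⟩ (h1 ⟨n, hn.trans (f.annihilator_le_of_injective hf)⟩)
      (h3 ⟨n, hn.trans (g.annihilator_le_of_surjective hg)⟩)

theorem GorK.prime (hG : GorK R d) (p : Ideal R) : p.IsPrime → ∀ i, d < i →
    Kills (1 : R) i (R ⧸ p) R := by
  induction p using WellFoundedGT.induction with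
  | ind p ih =>
  intro hp i hi
  by_cases hpm : p = maximalIdeal R
  · subst hpm
    exact hG.van i hi.ne'
  obtain ⟨x, hxm, hxp⟩ := SetLike.exists_of_lt (lt_of_le_of_ne (le_maximalIdeal hp.ne_top) hpm)
  have key : ∀ {N : Type u} [AddCommGroup N] [Module R N] (hN : Module.Finite R N),
      p ⊔ Ideal.span {x} ≤ Module.annihilator R N → Kills (1 : R) (i + 1) N R := by
    intro N _ _ hN
    induction hN using IsNoetherianRing.induction_on_isQuotientEquivQuotientPrime R with
    | subsingleton N => exact fun _ => kills_subsingleton N R _ 1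
    | quotient N q l =>
      intro hn
      rw [ann_quot_prime _ l] at hn
      have hlt : p < q.1 := by
        refine lt_of_le_of_ne (le_sup_left.trans hn) ?_
        rintro h
        exact hxp (h ▸ hn (Ideal.mem_sup_right (Ideal.mem_span_singleton_self x)))
      exact Kills.of_equiv l.symm (ih q.1 hlt q.2 (i + 1) (by omega))
    | exact N₁ N₂ N₃ f g hf hg hfg h1 h3 =>
      intro hn
      exact Ses.kills_mid ⟨hf, hg, hfg⟩ (h1 (hn.trans (f.annihilator_le_of_injective hf)))
        (h3 (hn.trans (g.annihilator_le_of_surjective hg)))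
  have hinj : Function.Injective (x • (LinearMap.id : (R ⧸ p) →ₗ[R] (R ⧸ p))) := by
    rw [injective_iff_map_eq_zero]
    intro a ha
    obtain ⟨a, rfl⟩ := Ideal.Quotient.mk_surjective a
    have : Ideal.Quotient.mk p (x * a) = 0 := ha
    rw [Ideal.Quotient.eq_zero_iff_mem] at this ⊢
    exact (hp.mem_or_mem this).resolve_left hxp
  refine kills_of_regular x hxm (ses_inj _ hinj) (key inferInstance ?_)
  rw [sup_le_iff]
  constructor
  · refine le_trans ?_ ((LinearMap.range (x • (LinearMap.id : (R ⧸ p) →ₗ[R] (R ⧸ p)))).mkQ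
      |>.annihilator_le_of_surjective (Submodule.mkQ_surjective _))
    rw [Ideal.annihilator_quotient]
  · rw [Ideal.span_singleton_le_iff_mem, Module.mem_annihilator]
    intro m
    obtain ⟨m, rfl⟩ := Submodule.mkQ_surjective _ m
    rw [← map_smul, Submodule.mkQ_apply, Submodule.Quotient.mk_eq_zero]
    exact ⟨m, rfl⟩

theorem GorK.high (hG : GorK R d) {N : Type u} [AddCommGroup N] [Module R N]
    (hN : Module.Finite R N) {i : ℕ} (hi : d < i) : Kills (1 : R) i N R := by
  induction hN using IsNoetherianRing.induction_on_isQuotientEquivQuotientPrime R with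
  | subsingleton N => exact kills_subsingleton N R _ 1
  | quotient N q l => exact Kills.of_equiv l.symm (hG.prime q.1 q.2 i hi)
  | exact N₁ N₂ N₃ f g hf hg hfg h1 h3 => exact Ses.kills_mid ⟨hf, hg, hfg⟩ h1 h3

open Pointwise in
theorem GorK.regular_step (hG : GorK R d) {N : Type u} [AddCommGroup N] [Module R N]
    [Module.Finite R N] {x : R} (hx : x ∈ maximalIdeal R) (hreg : IsSMulRegular N x) {i : ℕ}
    (hi : Kills (1 : R) (i + 1) (QuotSMulTop x N) R) : Kills (1 : R) i N R := by
  have hses : Ses (x • (LinearMap.id : N →ₗ[R] N)) (x • (⊤ : Submodule R N)).mkQ := by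
    refine ⟨hreg, Submodule.mkQ_surjective _, ?_⟩
    intro m
    rw [Submodule.mkQ_apply, Submodule.Quotient.mk_eq_zero, Submodule.mem_smul_pointwise_iff_exists]
    simp
  exact kills_of_regular x hx hses hi

theorem GorK.regular (hG : GorK R d) (l : List R) : ∀ (N : Type u) [AddCommGroup N] [Module R N]
    [Module.Finite R N], (∀ x ∈ l, x ∈ maximalIdeal R) →
    RingTheory.Sequence.IsWeaklyRegular N l → ∀ i, d < i + l.length → Kills (1 : R) i N R := by
  induction l with
  | nil =>
    intro N _ _ hN _ _ i hi
    exact hG.high hN (by simpa using hi)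
  | cons x l ih =>
    intro N _ _ _ hl hreg i hi
    rw [RingTheory.Sequence.isWeaklyRegular_cons_iff] at hreg
    refine hG.regular_step (hl x (by simp)) hreg.1 (ih _ (fun y hy => hl y (by simp [hy])) hreg.2 _ ?_)
    simp at hi
    omega

theorem exists_surj_residue (N : Type u) [AddCommGroup N] [Module R N] [Module.Finite R N]
    [Nontrivial N] : ∃ f : N →ₗ[R] ResidueField R, Function.Surjective f := by
  obtain ⟨K, hK, -⟩ := (eq_top_or_exists_le_coatom (⊥ : Submodule R N)).resolve_left bot_ne_top
  have hs : IsSimpleModule R (N ⧸ K) := isSimpleModule_iff_isCoatom.2 hK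
  obtain ⟨I, hI, ⟨l⟩⟩ := isSimpleModule_iff_quot_maximal.1 hs
  obtain rfl := IsLocalRing.eq_maximalIdeal hI
  exact ⟨l.toLinearMap ∘ₗ K.mkQ, l.surjective.comp K.mkQ_surjective⟩

theorem GorK.faithful (hG : GorK R d) (hd : 1 ≤ d) {E : Type u} [AddCommGroup E] [Module R E]
    [Module.Finite R E] (hE : ∃ n, maximalIdeal R ^ n ≤ Module.annihilator R E) (r : R)
    (hr : Kills r d E R) : ∀ e : E, r • e = 0 := by
  obtain ⟨d, rfl⟩ : ∃ n, d = n + 1 := ⟨d - 1, by omega⟩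
  obtain ⟨n, hn⟩ := hE
  let m : E →ₗ[R] E := r • LinearMap.id
  let I := LinearMap.range m
  have hI : Kills (1 : R) (d + 1) I R := by
    intro z
    have s1 := ses_quot I
    have s2 := ses_ker m.rangeRestrict m.surjective_rangeRestrict
    obtain ⟨y, rfl⟩ := s1.pre_surj (hG.high inferInstance (by omega)) z
    rw [one_smul]
    refine s2.pre_inj (hG.torsion inferInstance (by omega)
      ⟨n, hn.trans ((LinearMap.ker m.rangeRestrict).subtype.annihilator_le_of_injective
        Subtype.val_injective)⟩) _ ?_
    rw [pre_pre, show I.subtype ∘ₗ m.rangeRestrict = r • LinearMap.id from rfl, pre_smul_id, hr]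
  by_contra! hcon
  obtain ⟨e, he⟩ := hcon
  have : Nontrivial I := ⟨⟨⟨r • e, e, rfl⟩, 0, fun h => he (congrArg Subtype.val h)⟩⟩
  obtain ⟨f, hf⟩ := exists_surj_residue (R := R) I
  refine hG.ne ((ses_ker f hf).kills_right' (hG.torsion inferInstance (by omega) ⟨n, hn.trans ?_⟩) hI)
  exact (I.subtype.annihilator_le_of_injective Subtype.val_injective).trans
    ((LinearMap.ker f).subtype.annihilator_le_of_injective Subtype.val_injective)

end Gor

section Stable

variable {R}

open TensorProduct

/-- `a • id` factors through a finite free module -/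
def FactorsFree (a : R) (M : Type u) [AddCommGroup M] [Module R M] : Prop :=
  ∃ t : Module.Dual R M ⊗[R] M, dualTensorHom R M M t = a • LinearMap.id

theorem dualTensorHom_factor {M N : Type u} [AddCommGroup M] [Module R M] [AddCommGroup N]
    [Module R N] (t : Module.Dual R M ⊗[R] N) :
    ∃ (B : Type u) (_ : AddCommGroup B) (_ : Module R B) (_ : Module.Free R B)
      (_ : Module.Finite R B) (g : M →ₗ[R] B) (h : B →ₗ[R] N), h ∘ₗ g = dualTensorHom R M N t := by
  induction t with
  | zero => exact ⟨PUnit, _, _, inferInstance, inferInstance, 0, 0, by simp⟩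
  | tmul φ u =>
    exact ⟨R, _, _, inferInstance, inferInstance, φ, LinearMap.toSpanSingleton R N u, by
      ext; simp⟩
  | add t₁ t₂ h₁ h₂ =>
    obtain ⟨B₁, _, _, _, _, g₁, k₁, e₁⟩ := h₁
    obtain ⟨B₂, _, _, _, _, g₂, k₂, e₂⟩ := h₂
    refine ⟨B₁ × B₂, _, _, inferInstance, inferInstance, g₁.prod g₂, k₁.coprod k₂, ?_⟩
    rw [map_add, ← e₁, ← e₂]
    ext; simp

theorem factor_mem_range {M N ι : Type u} [AddCommGroup M] [Module R M] [AddCommGroup N]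
    [Module R N] [Finite ι] (g : M →ₗ[R] (ι → R)) (h : (ι → R) →ₗ[R] N) :
    ∃ t, dualTensorHom R M N t = h ∘ₗ g := by
  classical
  have := Fintype.ofFinite ι
  refine ⟨∑ i, (LinearMap.proj i ∘ₗ g) ⊗ₜ h (Pi.single i 1), ?_⟩
  ext m
  rw [map_sum]
  simp only [LinearMap.sum_apply, dualTensorHom_apply, LinearMap.comp_apply, LinearMap.proj_apply]
  conv_rhs => rw [pi_eq_sum_univ' (g m)]
  rw [map_sum]
  simp only [← map_smul]

variable {M : Type u} [AddCommGroup M] [Module R M]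

/-- ideal of elements `a` with `a • id` factoring through a finite free module -/
noncomputable def stabIdeal (M : Type u) [AddCommGroup M] [Module R M] : Ideal R :=
  (LinearMap.range (dualTensorHom R M M)).comap
    (LinearMap.toSpanSingleton R (M →ₗ[R] M) LinearMap.id)

theorem mem_stabIdeal (a : R) : a ∈ stabIdeal (R := R) M ↔ FactorsFree a M := Iff.rfl

theorem exists_pow_factors [IsNoetherianRing R] [IsLocalRing R] [Module.Finite R M]
    (hfree : ∀ (p : Ideal R) (hp : p.IsPrime), p ≠ maximalIdeal R →
      Module.Free (Localization.AtPrime p) (LocalizedModule p.primeCompl M)) :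
    ∃ n, ∀ a ∈ maximalIdeal R ^ n, FactorsFree a M := by
  suffices h : maximalIdeal R ≤ (stabIdeal (R := R) M).radical by
    obtain ⟨n, hn⟩ := Ideal.exists_pow_le_of_le_radical_of_fg h (IsNoetherian.noetherian _)
    exact ⟨n, fun a ha => hn ha⟩
  rw [Ideal.radical_eq_sInf, le_sInf_iff]
  rintro p ⟨hJp, hp⟩
  by_contra hpm
  have hne : p ≠ maximalIdeal R := fun h => hpm h.ge
  have := hfree p hp hne
  have hfp : Module.FinitePresentation R M := Module.finitePresentation_of_finite R M
  let Rp := Localization.AtPrime p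
  let Mp := LocalizedModule p.primeCompl M
  have : Module.Finite Rp Mp := inferInstance
  let ι := Module.Free.ChooseBasisIndex Rp Mp
  let e : Mp ≃ₗ[R] (ι → Rp) := (Module.Free.chooseBasis Rp Mp).equivFun.restrictScalars R
  let F : (ι → R) →ₗ[R] (ι → Rp) := LinearMap.pi fun i => Algebra.linearMap R Rp ∘ₗ LinearMap.proj i
  have hF : IsLocalizedModule p.primeCompl F := inferInstance
  let G := LocalizedModule.mkLinearMap p.primeCompl M
  obtain ⟨h, s, hs⟩ := Module.FinitePresentation.exists_lift_of_isLocalizedModule p.primeCompl F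
    (e.toLinearMap ∘ₗ G)
  have : Module.FinitePresentation R (ι → R) := Module.finitePresentation_of_finite R _
  obtain ⟨h', s', hs'⟩ := Module.FinitePresentation.exists_lift_of_isLocalizedModule p.primeCompl G
    (e.symm.toLinearMap ∘ₗ F)
  have h1 : G ∘ₗ (h' ∘ₗ h) = G ∘ₗ ((s'.1 * s.1) • LinearMap.id) := by
    rw [← LinearMap.comp_assoc, hs']
    ext m
    have h2 := LinearMap.congr_fun hs m
    simp only [LinearMap.comp_apply, LinearMap.smul_apply] at h2 ⊢
    rw [h2]
    simp [Submonoid.smul_def, mul_smul]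
  obtain ⟨t, ht⟩ := Module.Finite.exists_smul_of_comp_eq_of_isLocalizedModule p.primeCompl G _ _ h1
  have hmem : t.1 * (s'.1 * s.1) ∈ stabIdeal (R := R) M := by
    rw [mem_stabIdeal]
    obtain ⟨w, hw⟩ := factor_mem_range h (t.1 • h')
    refine ⟨w, hw.trans ?_⟩
    rw [LinearMap.smul_comp, mul_smul]
    exact ht
  exact (t * (s' * s)).2 (hJp hmem)

theorem FactorsFree.smul_mem_eval {a : R} (ha : FactorsFree a M)
    (c : Module.Dual R (Module.Dual R M)) : a • c ∈ LinearMap.range (Module.Dual.eval R M) := by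
  obtain ⟨t, ht⟩ := ha
  have key : ∀ (t : Module.Dual R M ⊗[R] M) (ψ : Module.Dual R M),
      ψ (TensorProduct.lid R M (c.rTensor M t)) = c (ψ ∘ₗ dualTensorHom R M M t) := by
    intro t ψ
    induction t with
    | zero => simp
    | tmul φ u =>
      have : ψ ∘ₗ dualTensorHom R M M (φ ⊗ₜ u) = ψ u • φ := by
        ext; simp [mul_comm]
      rw [this]
      simp [mul_comm]
    | add t₁ t₂ h₁ h₂ => simp [h₁, h₂, LinearMap.comp_add]
  refine ⟨TensorProduct.lid R M (c.rTensor M t), ?_⟩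
  ext ψ
  rw [Module.Dual.eval_apply, key, ht]
  have : ψ ∘ₗ (a • LinearMap.id) = a • ψ := by ext; simp
  rw [this]
  simp

theorem FactorsFree.smul_eq_zero {a : R} (ha : FactorsFree a M) (u : M)
    (hu : ∀ φ : Module.Dual R M, φ u = 0) : a • u = 0 := by
  obtain ⟨t, ht⟩ := ha
  have key : ∀ (t : Module.Dual R M ⊗[R] M), dualTensorHom R M M t u = 0 := by
    intro t
    induction t with
    | zero => simp
    | tmul φ v => simp [hu]
    | add t₁ t₂ h₁ h₂ => simp [h₁, h₂]
  rw [← key t, ht]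
  simp

theorem FactorsFree.ker_theta {a : R} (ha : FactorsFree a M) (z : Module.Dual R M ⊗[R] M)
    (hz : dualTensorHom R M M z = 0) : a • z = 0 := by
  have hz0 : (0 : M →ₗ[R] M).dualMap = 0 := by ext; simp
  obtain ⟨t, ht⟩ := ha
  have key : ∀ (t z : Module.Dual R M ⊗[R] M),
      (dualTensorHom R M M t).lTensor (Module.Dual R M) z =
        ((dualTensorHom R M M z).dualMap).rTensor M t := by
    intro t z
    induction z with
    | zero => simp [hz0]
    | add z₁ z₂ h₁ h₂ =>
      have : ∀ f g : M →ₗ[R] M, (f + g).dualMap = f.dualMap + g.dualMap := by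
        intro f g; ext; simp
      rw [map_add, map_add, h₁, h₂, this, LinearMap.rTensor_add]
      rfl
    | tmul ψ m =>
      induction t with
      | zero => simp
      | add t₁ t₂ h₁ h₂ => rw [map_add, map_add, LinearMap.lTensor_add, ← h₁, ← h₂]; rfl
      | tmul φ u =>
        have : (dualTensorHom R M M (ψ ⊗ₜ m)).dualMap φ = φ m • ψ := by
          ext; simp [mul_comm]
        simp [this, TensorProduct.smul_tmul]
  have := key t z
  rw [ht, hz] at this
  simpa [hz0] using this

theorem FactorsFree.ker_lTensor {a : R} (ha : FactorsFree a M) {K P : Type u} [AddCommGroup K]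
    [Module R K] [AddCommGroup P] [Module R P] (ι : K →ₗ[R] P) (hι : Function.Injective ι)
    (z : Module.Dual R M ⊗[R] K) (hz : ι.lTensor (Module.Dual R M) z = 0) : a • z = 0 := by
  obtain ⟨t, ht⟩ := ha
  obtain ⟨B, _, _, _, _, g, h, hgh⟩ := dualTensorHom_factor t
  have h1 : h.dualMap.rTensor K z = 0 := by
    apply Module.Flat.lTensor_preserves_injective_linearMap (M := Module.Dual R B) ι hι
    rw [map_zero, ← LinearMap.comp_apply, LinearMap.lTensor_comp_rTensor,
      ← LinearMap.rTensor_comp_lTensor, LinearMap.comp_apply, hz, map_zero]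
  have h2 : g.dualMap ∘ₗ h.dualMap = a • LinearMap.id := by
    rw [LinearMap.dualMap_comp_dualMap, hgh, ht]
    ext; simp
  have h3 : (g.dualMap ∘ₗ h.dualMap).rTensor K z = a • z := by
    rw [h2]; simp
  rw [← h3, LinearMap.rTensor_comp, LinearMap.comp_apply, h1, map_zero]

theorem FactorsFree.quot {a : R} (ha : FactorsFree a M) (f : M →ₗ[R] M) :
    a • f ∈ LinearMap.range (dualTensorHom R M M) := by
  obtain ⟨t, ht⟩ := ha
  have key : ∀ (t : Module.Dual R M ⊗[R] M),
      dualTensorHom R M M (f.lTensor _ t) = f ∘ₗ dualTensorHom R M M t := by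
    intro t
    induction t with
    | zero => simp
    | tmul φ v => ext; simp
    | add t₁ t₂ h₁ h₂ => simp [h₁, h₂, LinearMap.comp_add]
  refine ⟨f.lTensor _ t, ?_⟩
  rw [key, ht]
  ext; simp

theorem eval_bijective [IsLocalRing R] (hk : Kills (1 : R) 0 (ResidueField R) R) (n : ℕ)
    (hn : ∀ a ∈ maximalIdeal R ^ n, FactorsFree a M) (x y : R) (hx : x ∈ maximalIdeal R)
    (hy : y ∈ maximalIdeal R) (hxr : IsSMulRegular M x)
    (hyr : IsSMulRegular (QuotSMulTop x M) y) : Function.Bijective (Module.Dual.eval R M) := by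
  have hinj : Function.Injective (Module.Dual.eval R M) := by
    rw [injective_iff_map_eq_zero]
    intro u hu
    have h1 := (hn (x ^ n) (Ideal.pow_mem_pow hx n)).smul_eq_zero u
      (fun φ => LinearMap.congr_fun hu φ)
    exact (hxr.pow n) (by simpa using h1)
  refine ⟨hinj, ?_⟩
  have hsoc : ∀ c : R, (∀ z ∈ maximalIdeal R, z * c = 0) → c = 0 := by
    intro c hc
    let φ : ResidueField R →ₗ[R] R :=
      (maximalIdeal R).liftQ (LinearMap.toSpanSingleton R R c) (fun z hz => hc z hz)
    have h1 : (1 : R) • φ = 0 := (kills_zero_iff 1 _ _).1 hk φ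
    have h2 : (1 : R) • φ (Submodule.Quotient.mk 1) = 0 :=
      LinearMap.congr_fun h1 (Submodule.Quotient.mk 1)
    have h3 : φ (Submodule.Quotient.mk 1) = (1 : R) • c := rfl
    rw [h3] at h2
    simpa using h2
  have hstep : ∀ c : Module.Dual R (Module.Dual R M),
      (∀ z ∈ maximalIdeal R, z • c ∈ LinearMap.range (Module.Dual.eval R M)) →
      c ∈ LinearMap.range (Module.Dual.eval R M) := by
    intro c hc
    obtain ⟨a, ha⟩ := hc x hx
    obtain ⟨b, hb⟩ := hc y hy
    have hab : y • a = x • b := by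
      apply hinj
      rw [map_smul, map_smul, ha, hb, smul_comm]
    have h1 : (Submodule.Quotient.mk a : QuotSMulTop x M) = 0 := by
      apply hyr
      dsimp only
      rw [smul_zero, ← Submodule.Quotient.mk_smul, hab, Submodule.Quotient.mk_eq_zero]
      exact Submodule.smul_mem_pointwise_smul b x ⊤ trivial
    rw [Submodule.Quotient.mk_eq_zero] at h1
    obtain ⟨a', -, rfl⟩ := h1
    refine ⟨a', ?_⟩
    have h2 : x • (c - Module.Dual.eval R M a') = 0 := by
      rw [smul_sub, ← ha, ← map_smul]
      exact sub_self _
    have h3 : ∀ z ∈ maximalIdeal R, z • (c - Module.Dual.eval R M a') = 0 := by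
      intro z hz
      obtain ⟨w, hw⟩ := hc z hz
      have h4 : z • (c - Module.Dual.eval R M a') = Module.Dual.eval R M (w - z • a') := by
        rw [smul_sub, map_sub, hw, map_smul]
      have h5 : w - z • a' = 0 := by
        apply hxr
        apply hinj
        dsimp only
        rw [map_smul, ← h4, smul_comm, h2]
        simp
      rw [h4, h5, map_zero]
    rw [eq_comm, ← sub_eq_zero]
    ext ψ
    apply hsoc
    intro z hz
    exact LinearMap.congr_fun (h3 z hz) ψ
  have hall : ∀ n, ∀ c : Module.Dual R (Module.Dual R M),
      (∀ z ∈ maximalIdeal R ^ n, z • c ∈ LinearMap.range (Module.Dual.eval R M)) →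
      c ∈ LinearMap.range (Module.Dual.eval R M) := by
    intro n
    induction n with
    | zero =>
      intro c hc
      simpa using hc 1 (by simp)
    | succ n ih =>
      intro c hc
      refine hstep c fun z hz => ih _ fun w hw => ?_
      rw [← mul_smul]
      exact hc _ (by rw [pow_succ]; exact Ideal.mul_mem_mul hw hz)
  intro c
  exact hall n c fun z hz => (hn z hz).smul_mem_eval c

end Stable

section Final

variable {R}

open TensorProduct

theorem pre_add {A B X : Type u} [AddCommGroup A] [Module R A] [AddCommGroup B] [Module R B]
    [AddCommGroup X] [Module R X] (f g : A →ₗ[R] B) {i : ℕ}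
    (e : Abelian.Ext.{u} (ModuleCat.of R B) (ModuleCat.of R X) i) :
    pre (f + g) e = pre f e + pre g e := by
  have : ModuleCat.ofHom (f + g) = ModuleCat.ofHom f + ModuleCat.ofHom g := rfl
  rw [pre, this, Abelian.Ext.mk₀_add, Abelian.Ext.add_comp]
  rfl

theorem pre_zero_left {A B X : Type u} [AddCommGroup A] [Module R A] [AddCommGroup B] [Module R B]
    [AddCommGroup X] [Module R X] {i : ℕ}
    (e : Abelian.Ext.{u} (ModuleCat.of R B) (ModuleCat.of R X) i) :
    pre (0 : A →ₗ[R] B) e = 0 := by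
  have h := pre_add (0 : A →ₗ[R] B) 0 e
  rw [add_zero] at h
  simpa using h

theorem kills_pi {D X : Type u} [AddCommGroup D] [Module R D]
    [AddCommGroup X] [Module R X] (n : ℕ) {i : ℕ} (h : Kills (1 : R) i D X) :
    Kills (1 : R) i (Fin n → D) X := by
  classical
  intro e
  have key : ∀ s : Finset (Fin n),
      pre (∑ j ∈ s, (LinearMap.single R (fun _ : Fin n => D) j) ∘ₗ LinearMap.proj j) e = 0 := by
    intro s
    induction s using Finset.induction_on with
    | empty => rw [Finset.sum_empty, pre_zero_left]
    | insert a s ha ih =>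
      rw [Finset.sum_insert ha, pre_add, ih, ← pre_pre, h.eq_zero (pre _ e), pre_zero, add_zero]
  have h1 : (∑ j ∈ Finset.univ,
      (LinearMap.single R (fun _ : Fin n => D) j) ∘ₗ LinearMap.proj j) =
      (1 : R) • LinearMap.id := by
    rw [one_smul]
    ext x k
    simp [Finset.sum_apply, Pi.single_apply]
  rw [← pre_smul_id, ← h1, key]

theorem kills_tensor_pi {D X : Type u} [AddCommGroup D] [Module R D]
    [AddCommGroup X] [Module R X] (n : ℕ) {i : ℕ} (h : Kills (1 : R) i D X) :
    Kills (1 : R) i (D ⊗[R] (Fin n → R)) X :=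
  Kills.of_equiv (TensorProduct.piScalarRight R R D (Fin n)).symm (kills_pi n h)

theorem Kills.fst {M X Y : Type u} [AddCommGroup M] [Module R M] [AddCommGroup X] [Module R X]
    [AddCommGroup Y] [Module R Y] {r : R} {i : ℕ} (h : Kills r i M (X × Y)) : Kills r i M X := by
  intro e
  let a := Abelian.Ext.mk₀ (ModuleCat.ofHom (LinearMap.inl R X Y))
  let b := Abelian.Ext.mk₀ (ModuleCat.ofHom (LinearMap.fst R X Y))
  have h1 := h (e.comp a (add_zero i))
  have h2 : (e.comp a (add_zero i)).comp b (add_zero i) = e := by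
    rw [Abelian.Ext.comp_assoc_of_third_deg_zero]
    have : a.comp b (add_zero 0) = Abelian.Ext.mk₀ (𝟙 (ModuleCat.of R X)) := by
      simp only [a, b, Abelian.Ext.mk₀_comp_mk₀, ← ModuleCat.ofHom_comp, LinearMap.fst_comp_inl]
      rfl
    rw [this, Abelian.Ext.comp_mk₀_id]
  rw [← h2, ← Abelian.Ext.smul_comp, h1, Abelian.Ext.zero_comp]

theorem Ses.split_smul {A B C : Type u} [AddCommGroup A] [Module R A] [AddCommGroup B] [Module R B]
    [AddCommGroup C] [Module R C] {f : A →ₗ[R] B} {g : B →ₗ[R] C} (h : Ses f g) {r : R}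
    (hr : Kills r 1 C A) : ∃ s : C →ₗ[R] B, g ∘ₗ s = r • LinearMap.id := by
  have h0 : (Abelian.Ext.mk₀ (r • 𝟙 h.sc.X₃)).comp h.shortExact.extClass (zero_add 1)
      = 0 := by
    rw [Abelian.Ext.mk₀_smul, Abelian.Ext.smul_comp, Abelian.Ext.mk₀_id_comp]
    exact hr _
  obtain ⟨y, hy⟩ := Abelian.Ext.covariant_sequence_exact₃ h.sc.X₃ h.shortExact
    (Abelian.Ext.mk₀ (r • 𝟙 h.sc.X₃)) (zero_add 1) h0
  obtain ⟨s, rfl⟩ := (Abelian.Ext.mk₀_bijective _ _).2 y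
  rw [Abelian.Ext.mk₀_comp_mk₀] at hy
  have hy' := (Abelian.Ext.mk₀_bijective _ _).1 hy
  refine ⟨s.hom, ?_⟩
  exact congrArg ModuleCat.Hom.hom hy'

theorem ses_range {W Y Z : Type u} [AddCommGroup W] [Module R W]
    [AddCommGroup Y] [Module R Y] [AddCommGroup Z] [Module R Z] (T : W →ₗ[R] Y) (g : Y →ₗ[R] Z)
    (h : Function.Exact T g) (hg : Function.Surjective g) : Ses (LinearMap.range T).subtype g := by
  refine ⟨Subtype.val_injective, hg, ?_⟩
  rw [LinearMap.exact_iff, Submodule.range_subtype]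
  exact LinearMap.exact_iff.1 h

theorem kills_one_of_exact {W Y Z X : Type u} [AddCommGroup W] [Module R W]
    [AddCommGroup Y] [Module R Y] [AddCommGroup Z] [Module R Z] [AddCommGroup X] [Module R X]
    (T : W →ₗ[R] Y) (g : Y →ₗ[R] Z)
    (h : Function.Exact T g) (hg : Function.Surjective g) (hY : Kills (1 : R) 1 Y X) (r : R)
    (hφ : ∀ φ : W →ₗ[R] X, ∃ ψ : Y →ₗ[R] X, ψ ∘ₗ T = r • φ) : Kills r 1 Z X := by
  rw [(ses_range T g h hg).kills_one_iff hY]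
  intro φ
  obtain ⟨ψ, hψ⟩ := hφ (φ ∘ₗ T.rangeRestrict)
  refine ⟨ψ, ?_⟩
  ext ⟨_, z, rfl⟩
  exact LinearMap.congr_fun hψ z

variable [IsNoetherianRing R] [IsLocalRing R] {d : ℕ}

theorem GorK.kills_range (hG : GorK R d) {W Y : Type u} [AddCommGroup W] [Module R W]
    [AddCommGroup Y] [Module R Y] [Module.Finite R W] (T : W →ₗ[R] Y) (n : ℕ)
    (hT : ∀ a ∈ maximalIdeal R ^ n, ∀ z, T z = 0 → a • z = 0) {i : ℕ} (hi : i < d) {r : R}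
    (hW : Kills r (i + 1) W R) : Kills r (i + 1) (LinearMap.range T) R := by
  refine (ses_ker T.rangeRestrict T.surjective_rangeRestrict).kills_right' ?_ hW
  refine hG.torsion inferInstance hi ⟨n, fun a ha => ?_⟩
  rw [Module.mem_annihilator]
  rintro ⟨z, hz⟩
  refine Subtype.ext ?_
  exact hT a ha z (congrArg Subtype.val hz)

theorem GorK.dual_van (hG : GorK R d) (n : ℕ) : ∀ (M : Type u) [AddCommGroup M] [Module R M]
    [Module.Finite R M], (∀ i, Kills (1 : R) (i + 1) M R) → ∀ i, d < i + 1 + n →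
    Kills (1 : R) (i + 1) (Module.Dual R M) R := by
  induction n with
  | zero =>
    intro M _ _ _ _ i hi
    exact hG.high (inferInstanceAs (Module.Finite R (M →ₗ[R] R))) (by omega)
  | succ n ih =>
    intro M _ _ _ hM i hi
    obtain ⟨k, f, hf⟩ := Module.Finite.exists_fin' R M
    have hs := ses_ker f hf
    have hK : ∀ i, Kills (1 : R) (i + 1) (LinearMap.ker f) R := fun i =>
      hs.kills_left (kills_free i 1) (hM (i + 1))
    have h1 := (hs.kills_one_iff (kills_free 0 1) 1).1 (hM 0)
    have hdual : Ses f.dualMap (LinearMap.ker f).subtype.dualMap := by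
      refine ⟨LinearMap.dualMap_injective_of_surjective hf, ?_, ?_⟩
      · intro φ
        obtain ⟨ψ, hψ⟩ := h1 φ
        exact ⟨ψ, by rw [one_smul] at hψ; exact hψ⟩
      · intro ψ
        constructor
        · intro h
          have hle : LinearMap.ker f ≤ LinearMap.ker ψ := fun x hx =>
            LinearMap.congr_fun h ⟨x, hx⟩
          let l := f.quotKerEquivOfSurjective hf
          refine ⟨(LinearMap.ker f).liftQ ψ hle ∘ₗ l.symm.toLinearMap, ?_⟩
          ext x
          have : l.symm (f (Pi.single x 1)) = Submodule.Quotient.mk (Pi.single x 1) := by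
            rw [LinearEquiv.symm_apply_eq]; rfl
          simp [this]
        · rintro ⟨χ, rfl⟩
          ext ⟨x, hx⟩
          simp [LinearMap.mem_ker.1 hx]
    exact hdual.kills_left (kills_free i 1) (ih _ hK (i + 1) (by omega))

theorem GorK.claim_step (hG : GorK R d) {W Y Z : Type u} [AddCommGroup W] [Module R W]
    [AddCommGroup Y] [Module R Y] [AddCommGroup Z] [Module R Z] [Module.Finite R W]
    (T : W →ₗ[R] Y) (g : Y →ₗ[R] Z)
    (h : Function.Exact T g) (hg : Function.Surjective g) (n : ℕ)
    (hT : ∀ a ∈ maximalIdeal R ^ n, ∀ z, T z = 0 → a • z = 0) {i : ℕ} (hi : i < d) {r : R}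
    (hW : Kills r (i + 1) W R) (hY : Kills (1 : R) (i + 2) Y R) : Kills r (i + 2) Z R :=
  (ses_range T g h hg).kills_right (hG.kills_range T n hT hi hW) hY

theorem GorK.claim (hG : GorK R d) (M : Type u) [AddCommGroup M] [Module R M]
    [Module.Finite R M] (hD : ∀ i, Kills (1 : R) (i + 1) (Module.Dual R M) R) (n : ℕ)
    (hn : ∀ a ∈ maximalIdeal R ^ n, FactorsFree a M)
    (hev : Function.Bijective (Module.Dual.eval R M)) (r : R) (i : ℕ) : i < d →
    ∀ (N : Type u) [AddCommGroup N] [Module R N] [Module.Finite R N],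
    Kills r (i + 1) N M → Kills r (i + 1) (Module.Dual R M ⊗[R] N) R := by
  have hfinD : Module.Finite R (Module.Dual R M) := inferInstanceAs (Module.Finite R (M →ₗ[R] R))
  induction i with
  | zero =>
    intro hi N _ _ _ hN
    obtain ⟨k, f, hf⟩ := Module.Finite.exists_fin' R N
    have hs := ses_ker f hf
    let T := (LinearMap.ker f).subtype.lTensor (Module.Dual R M)
    refine kills_one_of_exact (W := Module.Dual R M ⊗[R] LinearMap.ker f)
      (Y := Module.Dual R M ⊗[R] (Fin k → R)) (Z := Module.Dual R M ⊗[R] N) T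
      (f.lTensor (Module.Dual R M)) (lTensor_exact (Module.Dual R M) hs.exact hf)
      (LinearMap.lTensor_surjective _ hf) (kills_tensor_pi k (hD 0)) r ?_
    intro φ
    have h1 := (hs.kills_one_iff (kills_free 0 1) r).1 hN
    let ev := LinearEquiv.ofBijective _ hev
    let χ : LinearMap.ker f →ₗ[R] M := ev.symm.toLinearMap ∘ₗ
      (TensorProduct.mk R (Module.Dual R M) (LinearMap.ker f)).flip.compr₂ φ
    obtain ⟨ψ, hψ⟩ := h1 χ
    refine ⟨contractLeft R M ∘ₗ ψ.lTensor (Module.Dual R M), ?_⟩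
    refine TensorProduct.ext' fun a x => ?_
    have h3 : ψ x = r • χ x := LinearMap.congr_fun hψ x
    have h5 : Module.Dual.eval R M (χ x) a = φ (a ⊗ₜ x) := by
      have : ev (χ x) = _ := ev.apply_symm_apply _
      exact LinearMap.congr_fun this a
    rw [Module.Dual.eval_apply] at h5
    simp [T, h3, h5]
  | succ i ih =>
    intro hi N _ _ _ hN
    obtain ⟨k, f, hf⟩ := Module.Finite.exists_fin' R N
    have hs := ses_ker f hf
    let T := (LinearMap.ker f).subtype.lTensor (Module.Dual R M)
    have hK : Kills r (i + 1) (LinearMap.ker f) M := hs.kills_left (kills_free i 1) hN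
    have h1 := ih (by omega) (LinearMap.ker f) hK
    exact hG.claim_step (W := Module.Dual R M ⊗[R] LinearMap.ker f)
      (Y := Module.Dual R M ⊗[R] (Fin k → R)) (Z := Module.Dual R M ⊗[R] N) T
      (f.lTensor (Module.Dual R M)) (lTensor_exact (Module.Dual R M) hs.exact hf)
      (LinearMap.lTensor_surjective _ hf) n
      (fun a ha z hz => (hn a ha).ker_lTensor _ Subtype.val_injective z hz) (by omega) h1
      (kills_tensor_pi k (hD _))

theorem GorK.main (hG : GorK R d) (hd : 2 ≤ d) (M : Type u) [AddCommGroup M] [Module R M]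
    [Module.Finite R M] (hD : ∀ i, Kills (1 : R) (i + 1) (Module.Dual R M) R) (n : ℕ)
    (hn : ∀ a ∈ maximalIdeal R ^ n, FactorsFree a M)
    (hev : Function.Bijective (Module.Dual.eval R M)) (x : R) (hx : x ∈ maximalIdeal R)
    (hxr : IsSMulRegular M x) (r : R) (hr : Kills r (d - 1) M M) : FactorsFree r M := by
  have hfinD : Module.Finite R (Module.Dual R M) := inferInstanceAs (Module.Finite R (M →ₗ[R] R))
  obtain ⟨e, rfl⟩ : ∃ e, d = e + 2 := ⟨d - 2, by omega⟩
  have h1 := hG.claim M hD n hn hev r e (by omega) M hr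
  let θ := dualTensorHom R M M
  have h2 := hG.kills_range (W := Module.Dual R M ⊗[R] M) (Y := M →ₗ[R] M) θ n
    (fun a ha z hz => (hn a ha).ker_theta z hz) (by omega) h1
  have h3 : Kills (1 : R) (e + 2) (M →ₗ[R] M) R := by
    refine hG.regular [x] (M →ₗ[R] M) (by simpa using hx) ?_ _ (by simp)
    rw [RingTheory.Sequence.isWeaklyRegular_cons_iff]
    refine ⟨?_, RingTheory.Sequence.IsWeaklyRegular.nil _ _⟩
    intro f g hfg
    ext m
    exact hxr (LinearMap.congr_fun hfg m)
  have h4 : Kills r (e + 2) ((M →ₗ[R] M) ⧸ LinearMap.range θ) R :=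
    (ses_quot (LinearMap.range θ)).kills_right h2 h3
  have h5 := hG.faithful (by omega) (E := (M →ₗ[R] M) ⧸ LinearMap.range θ)
    ⟨n, fun a ha => by
      rw [Module.mem_annihilator]
      intro q
      obtain ⟨f, rfl⟩ := Submodule.Quotient.mk_surjective _ q
      rw [← Submodule.Quotient.mk_smul, Submodule.Quotient.mk_eq_zero]
      exact (hn a ha).quot f⟩ r h4 (Submodule.Quotient.mk LinearMap.id)
  rw [← Submodule.Quotient.mk_smul, Submodule.Quotient.mk_eq_zero] at h5
  exact h5


end Final

/-- Over a Gorenstein local ring of dimension `d ≥ 2`, for a maximal Cohen–Macaulay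
module `M` free on the punctured spectrum, the Auslander–Reiten annihilator of `M`
equals its stable annihilator `ann Ext¹(M, ΩM)`. -/
theorem stmt16 (R : Type u) [CommRing R] [IsNoetherianRing R] [IsLocalRing R]
    (hGor : IsGorensteinLocal R)
    (d : ℕ) (hd : 2 ≤ d) (hdim : ringKrullDim R = (d : ℕ))
    (M : Type u) [AddCommGroup M] [Module R M] (hM : IsMCM R M)
    (hfree : ∀ (p : Ideal R) (hp : p.IsPrime), p ≠ maximalIdeal R →
      Module.Free (Localization.AtPrime p) (LocalizedModule p.primeCompl M))
    (S : Type u) [AddCommGroup S] [Module R S] (hS : IsSyzygy R M S) :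
    ARann R M = extAnn R 1 M S := by
  obtain ⟨hfin, hdep⟩ := hM
  have hG := gorK hGor d hd hdim
  obtain ⟨n, hn⟩ := exists_pow_factors (M := M) hfree
  obtain ⟨rs, hrm, hreg, hlen⟩ : ∃ rs : List R, (∀ r ∈ rs, r ∈ maximalIdeal R) ∧
      RingTheory.Sequence.IsRegular M rs ∧ d ≤ rs.length := by
    have h1 : moduleDepth R M = (d : ℕ∞) := by
      rw [hdim] at hdep
      exact_mod_cast hdep
    have h2 : ((d - 1 : ℕ) : ℕ∞) < moduleDepth R M := by
      rw [h1]
      exact_mod_cast (by omega : d - 1 < d)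
    rw [moduleDepth, lt_sSup_iff] at h2
    obtain ⟨k, ⟨rs, ha, hb, rfl⟩, h3⟩ := h2
    refine ⟨rs, ha, hb, ?_⟩
    have h4 : d - 1 < rs.length := by exact_mod_cast h3
    omega
  have hMvan : ∀ i, Kills (1 : R) (i + 1) M R := fun i =>
    hG.regular rs M hrm hreg.toIsWeaklyRegular (i + 1) (by omega)
  have hD : ∀ i, Kills (1 : R) (i + 1) (Module.Dual R M) R := fun i =>
    hG.dual_van d M hMvan i (by omega)
  obtain ⟨x, y, l, rfl⟩ : ∃ x y l, rs = x :: y :: l := by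
    match rs, hlen with
    | [], h => simp at h; omega
    | [_], h => simp at h; omega
    | x :: y :: l, _ => exact ⟨x, y, l, rfl⟩
  have hwr := hreg.toIsWeaklyRegular
  rw [RingTheory.Sequence.isWeaklyRegular_cons_iff,
    RingTheory.Sequence.isWeaklyRegular_cons_iff] at hwr
  obtain ⟨hxr, hyr, -⟩ := hwr
  have hx := hrm x (by simp)
  have hev := eval_bijective (hG.van 0 (by omega)) n hn x y hx (hrm y (by simp)) hxr hyr
  ext r
  constructor
  · intro hr
    have h1 : r ∈ extAnn R (d - 2 + 1) M (M × R) := (Submodule.mem_iInf _).1 hr (d - 2)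
    rw [mem_extAnn_iff, show d - 2 + 1 = d - 1 by omega] at h1
    obtain ⟨t, ht⟩ := hG.main hd M hD n hn hev x hx hxr r h1.fst
    obtain ⟨B, _, _, _, _, g, h, hgh⟩ := dualTensorHom_factor t
    rw [mem_extAnn_iff r 0]
    exact Kills.of_factor g h (hgh.trans ht) (kills_free 0 1)
  · intro hr
    rw [mem_extAnn_iff r 0] at hr
    obtain ⟨F, _, _, ι, π, hF, -, hι, hπ, hιπ⟩ := hS
    have hses : Ses ι π := ⟨hι, hπ, LinearMap.exact_iff.2 hιπ.symm⟩
    obtain ⟨s, hs⟩ := hses.split_smul hr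
    refine (Submodule.mem_iInf _).2 fun i => ?_
    rw [mem_extAnn_iff]
    exact Kills.of_factor s π hs (kills_free i 1)
end
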